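/- arXiv:1507.05318 — 3 statements merged into one kernel-verified Lean document; each statement's English description precedes it below -/
import Mathlib

section
/- Let n be a real parameter with 2 < n < 4, θ1 ∈ (0,∞), α = (2−n)/2. Suppose L1 > 0 and there exists a twice differentiable function y : (0,θ1] → ℝ with y''(θ) + coth(θ)·y'(θ) + (L1 − α²/sinh²(θ))·y(θ) = 0 on (0,θ1), y(θ) > 0 for θ ∈ (0,θ1), y(θ1) = 0, and lim_{θ→0⁺} θ^{α}·y(θ) exists and is a positive real number. Then λ1 = n(n−2)/4 + L1. -/
open Real Set Filter

noncomputable section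

/-- The hyperbolic cotangent. -/
def Real.coth (x : ℝ) : ℝ := Real.cosh x / Real.sinh x

/-- There is a (suitably normalized) solution `y` of the Legendre-type equation
`y'' + coth θ · y' + (L - α²/sinh²θ) y = 0` on `(0,θ1)` which is positive on
`(0,θ1)`, vanishes at `θ1`, and is such that `θ^e · y(θ)` has a positive limit
as `θ → 0⁺`.  (For `e = -α` this encodes `y(θ) = P_ℓ^{-α}(cosh θ)` with
`L = -ℓ(ℓ+1)`; for `e = α` it encodes `y(θ) = P_ℓ^{α}(cosh θ)`.) -/
def LegendreSol (θ1 α L e : ℝ) : Prop :=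
  ∃ y y' y'' : ℝ → ℝ,
    ContinuousOn y (Ioc 0 θ1) ∧
    (∀ θ ∈ Ioo (0:ℝ) θ1, HasDerivAt y (y' θ) θ) ∧
    (∀ θ ∈ Ioo (0:ℝ) θ1, HasDerivAt y' (y'' θ) θ) ∧
    (∀ θ ∈ Ioo (0:ℝ) θ1,
      y'' θ + Real.coth θ * y' θ + (L - α ^ 2 / Real.sinh θ ^ 2) * y θ = 0) ∧
    (∀ θ ∈ Ioo (0:ℝ) θ1, 0 < y θ) ∧
    y θ1 = 0 ∧
    ∃ c : ℝ, 0 < c ∧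
      Tendsto (fun θ : ℝ => θ ^ e * y θ) (nhdsWithin 0 (Ioi 0)) (nhds c)

/-- The first Dirichlet eigenvalue of `-u'' - (n-1) coth θ u' = λ u` on `(0,θ1)`,
defined variationally as the infimum of the Rayleigh quotient over nonzero
`C¹` functions on `[0,θ1]` vanishing at `θ1`. -/
def lambda1 (n θ1 : ℝ) : ℝ :=
  sInf { q : ℝ | ∃ u : ℝ → ℝ,
    ContDiffOn ℝ 1 u (Icc 0 θ1) ∧ (∃ θ ∈ Icc (0:ℝ) θ1, u θ ≠ 0) ∧ u θ1 = 0 ∧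
    q = (∫ θ in (0:ℝ)..θ1,
            (derivWithin u (Icc 0 θ1) θ) ^ 2 * Real.sinh θ ^ (n - 1)) /
        (∫ θ in (0:ℝ)..θ1, (u θ) ^ 2 * Real.sinh θ ^ (n - 1)) }


theorem aux_ptwise_cont {w U w' V : ℝ → ℝ} {b : ℝ} (hb : 0 < b)
    (hU : ∀ θ ∈ Icc (0:ℝ) b, HasDerivWithinAt U (V θ) (Icc 0 b) θ)
    (hw : ∀ θ ∈ Icc (0:ℝ) b, HasDerivWithinAt w (w' θ) (Icc 0 b) θ)
    (hpos : ∀ θ ∈ Ico (0:ℝ) b, 0 < U θ) (hUb : U b = 0) (hVb : V b ≠ 0) (hwb : w b = 0) :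
    ContinuousOn (fun θ => w θ ^ 2 / U θ) (Icc 0 b) := by
  intro θ hθ
  rcases hθ.2.lt_or_eq with h | h
  · exact ((hw θ hθ).continuousWithinAt.pow 2).div (hU θ hθ).continuousWithinAt
      (hpos θ ⟨hθ.1, h⟩).ne'
  · subst h
    have h1 := hasDerivWithinAt_iff_tendsto_slope.1 (hU θ hθ)
    have h2 := hasDerivWithinAt_iff_tendsto_slope.1 (hw θ hθ)
    have h3 : Tendsto w (nhdsWithin θ (Icc 0 θ \ {θ})) (nhds (w θ)) :=
      (hw θ hθ).continuousWithinAt.tendsto.mono_left (nhdsWithin_mono _ sdiff_subset)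
    have h4 := (h3.mul h2).div h1 hVb
    rw [hwb] at h4
    simp only [zero_mul, zero_div] at h4
    rw [← continuousWithinAt_sdiff_self, ContinuousWithinAt]
    simp only [hwb, hUb, div_zero]
    refine h4.congr' ?_
    filter_upwards [self_mem_nhdsWithin] with x hx
    have hx1 : x ≠ θ := hx.2
    have hx2 : U x ≠ 0 := (hpos x ⟨hx.1.1, lt_of_le_of_ne hx.1.2 hx1⟩).ne'
    have hx3 : x - θ ≠ 0 := sub_ne_zero.2 hx1
    simp only [slope_def_field, hwb, hUb, sub_zero, Pi.div_apply]
    field_simp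

theorem picone {p w U w' V : ℝ → ℝ} {b lam : ℝ} (hb : 0 < b)
    (hp : ContinuousOn p (Icc 0 b)) (hp0 : ∀ θ ∈ Icc (0:ℝ) b, 0 ≤ p θ)
    (hU : ∀ θ ∈ Icc (0:ℝ) b, HasDerivWithinAt U (V θ) (Icc 0 b) θ)
    (hV : ContinuousOn V (Icc 0 b))
    (hG : ∀ θ ∈ Ioo (0:ℝ) b, HasDerivAt (fun θ => p θ * V θ) (-lam * p θ * U θ) θ)
    (hG0 : V 0 = 0)
    (hpos : ∀ θ ∈ Ico (0:ℝ) b, 0 < U θ) (hUb : U b = 0) (hVb : V b ≠ 0)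
    (hw : ∀ θ ∈ Icc (0:ℝ) b, HasDerivWithinAt w (w' θ) (Icc 0 b) θ)
    (hw' : ContinuousOn w' (Icc 0 b)) (hwb : w b = 0) :
    lam * ∫ θ in (0:ℝ)..b, w θ ^ 2 * p θ ≤ ∫ θ in (0:ℝ)..b, w' θ ^ 2 * p θ := by
  have hwc : ContinuousOn w (Icc 0 b) := fun θ hθ => (hw θ hθ).continuousWithinAt
  have hc1 : ContinuousOn (fun θ => w' θ ^ 2 * p θ) (Icc 0 b) := (hw'.pow 2).mul hp
  have hc2 : ContinuousOn (fun θ => lam * (w θ ^ 2 * p θ)) (Icc 0 b) :=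
    continuousOn_const.mul ((hwc.pow 2).mul hp)
  have hi1 := hc1.intervalIntegrable_of_Icc (μ := MeasureTheory.volume) hb.le
  have hi2 := hc2.intervalIntegrable_of_Icc (μ := MeasureTheory.volume) hb.le
  have key := intervalIntegral.sub_le_integral_of_hasDeriv_right_of_le (a := 0) (b := b)
    (g := fun θ => (p θ * V θ) * (w θ ^ 2 / U θ))
    (g' := fun θ => (-lam * p θ * U θ) * (w θ ^ 2 / U θ) + (p θ * V θ) *
      ((2 * w θ * w' θ * U θ - w θ ^ 2 * V θ) / U θ ^ 2))
    (φ := fun θ => w' θ ^ 2 * p θ - lam * (w θ ^ 2 * p θ)) hb.le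
    ((hp.mul hV).mul (aux_ptwise_cont hb hU hw hpos hUb hVb hwb)) ?_
    (hc1.sub hc2).integrableOn_Icc ?_
  · rw [intervalIntegral.integral_sub hi1 hi2, intervalIntegral.integral_const_mul] at key
    simp only [hG0, hwb] at key
    norm_num at key
    exact key
  · intro x hx
    have hn : Icc 0 b ∈ nhds x := Icc_mem_nhds hx.1 hx.2
    have h1 := (hU x (Ioo_subset_Icc_self hx)).hasDerivAt hn
    have h2 := (hw x (Ioo_subset_Icc_self hx)).hasDerivAt hn
    have h3 := (hG x hx).mul ((h2.pow 2).div h1 (hpos x (Ioo_subset_Ico_self hx)).ne')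
    refine (h3.congr_deriv ?_).hasDerivWithinAt
    simp
  · intro x hx
    have h1 := hpos x (Ioo_subset_Ico_self hx)
    have h2 := hp0 x (Ioo_subset_Icc_self hx)
    have : w' x ^ 2 * p x - lam * (w x ^ 2 * p x) - ((-lam * p x * U x) * (w x ^ 2 / U x) +
      (p x * V x) * ((2 * w x * w' x * U x - w x ^ 2 * V x) / U x ^ 2))
      = p x * (w' x - w x * V x / U x) ^ 2 := by
      field_simp
      ring
    have h3 : 0 ≤ p x * (w' x - w x * V x / U x) ^ 2 := by positivity
    linarith

theorem eigen_eq {p U V : ℝ → ℝ} {b lam : ℝ} (hb : 0 < b)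
    (hp : ContinuousOn p (Icc 0 b))
    (hU : ∀ θ ∈ Icc (0:ℝ) b, HasDerivWithinAt U (V θ) (Icc 0 b) θ)
    (hV : ContinuousOn V (Icc 0 b))
    (hG : ∀ θ ∈ Ioo (0:ℝ) b, HasDerivAt (fun θ => p θ * V θ) (-lam * p θ * U θ) θ)
    (hG0 : V 0 = 0) (hUb : U b = 0) :
    lam * ∫ θ in (0:ℝ)..b, U θ ^ 2 * p θ = ∫ θ in (0:ℝ)..b, V θ ^ 2 * p θ := by
  have hwc : ContinuousOn U (Icc 0 b) := fun θ hθ => (hU θ hθ).continuousWithinAt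
  have hc1 : ContinuousOn (fun θ => V θ ^ 2 * p θ) (Icc 0 b) := (hV.pow 2).mul hp
  have hc2 : ContinuousOn (fun θ => lam * (U θ ^ 2 * p θ)) (Icc 0 b) :=
    continuousOn_const.mul ((hwc.pow 2).mul hp)
  have hi1 := hc1.intervalIntegrable_of_Icc (μ := MeasureTheory.volume) hb.le
  have hi2 := hc2.intervalIntegrable_of_Icc (μ := MeasureTheory.volume) hb.le
  have key := intervalIntegral.integral_eq_sub_of_hasDerivAt_of_le (a := 0) (b := b)
    (f := fun θ => (p θ * V θ) * U θ)
    (f' := fun θ => V θ ^ 2 * p θ - lam * (U θ ^ 2 * p θ)) hb.le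
    ((hp.mul hV).mul hwc) ?_ (hi1.sub hi2)
  · rw [intervalIntegral.integral_sub hi1 hi2, intervalIntegral.integral_const_mul] at key
    simp only [hG0, hUb] at key
    norm_num at key
    linarith
  · intro x hx
    have hn : Icc 0 b ∈ nhds x := Icc_mem_nhds hx.1 hx.2
    have h1 := (hU x (Ioo_subset_Icc_self hx)).hasDerivAt hn
    refine ((hG x hx).mul h1).congr_deriv ?_
    ring

/-- no singular part -/
theorem no_sing {p U u' : ℝ → ℝ} {b k : ℝ} (hb : 0 < b)
    (hUc : ContinuousOn U (Icc 0 b))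
    (hU : ∀ θ ∈ Ioo (0:ℝ) b, HasDerivAt U (u' θ) θ)
    (hlim : Tendsto (fun θ => p θ * u' θ) (nhdsWithin 0 (Ioi 0)) (nhds k))
    (hple : ∀ᶠ θ in nhdsWithin (0:ℝ) (Ioi 0), 0 < p θ ∧ p θ ≤ 2 * θ) : k = 0 := by
  by_contra hk
  have hk' : 0 < |k| := abs_pos.2 hk
  have e1 : ∀ᶠ θ in nhdsWithin (0:ℝ) (Ioi 0), |k| / 2 < |p θ * u' θ| :=
    hlim.abs.eventually (lt_mem_nhds (by linarith))
  have e2 : ∀ᶠ θ in nhdsWithin (0:ℝ) (Ioi 0), |U θ - U 0| < |k| / 32 := by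
    have h0 : Tendsto U (nhdsWithin 0 (Ioi 0)) (nhds (U 0)) := by
      have := (hUc 0 ⟨le_rfl, hb.le⟩).tendsto
      rw [nhdsWithin_Icc_eq_nhdsGE hb] at this
      exact this.mono_left (nhdsWithin_mono _ Ioi_subset_Ici_self)
    have h1 : Tendsto (fun θ => |U θ - U 0|) (nhdsWithin 0 (Ioi 0)) (nhds |U 0 - U 0|) :=
      (h0.sub_const _).abs
    refine h1.eventually (gt_mem_nhds ?_)
    simp; positivity
  obtain ⟨d, hd, hd'⟩ := mem_nhdsGT_iff_exists_Ioo_subset.1 ((e1.and e2).and hple)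
  have hd0 : 0 < d := hd
  set m := min d b with hm
  have hm0 : 0 < m := lt_min hd0 hb
  have hmd : m ≤ d := min_le_left _ _
  have hmb : m ≤ b := min_le_right _ _
  obtain ⟨ξ, hξ, hξ'⟩ := exists_hasDerivAt_eq_slope U u' (a := m / 4) (b := m / 2) (by linarith)
    (hUc.mono (Icc_subset_Icc (by linarith) (by linarith)))
    (fun x hx => hU x ⟨by linarith [hx.1], by linarith [hx.2]⟩)
  have g1 := (@hd' (m/4) ⟨by linarith, by linarith⟩).1.2
  have g2 := (@hd' (m/2) ⟨by linarith, by linarith⟩).1.2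
  obtain ⟨⟨g3, _⟩, g4, g5⟩ := @hd' ξ ⟨by linarith [hξ.1], by linarith [hξ.2]⟩
  have h6 : u' ξ * (m / 4) = U (m/2) - U (m/4) := by
    rw [hξ']; field_simp; ring
  rw [abs_mul, abs_of_pos g4] at g3
  have h7 : |u' ξ| * (m / 4) < |k| / 16 := by
    have : |u' ξ * (m/4)| = |u' ξ| * (m/4) := by
      rw [abs_mul, abs_of_pos (by linarith : 0 < m/4)]
    rw [← this, h6]
    rw [abs_lt] at *
    constructor <;> linarith
  have h8 : p ξ * |u' ξ| ≤ m * |u' ξ| :=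
    mul_le_mul_of_nonneg_right (by linarith [hξ.2]) (abs_nonneg _)
  linarith

theorem regularity {p U u' : ℝ → ℝ} {b lam : ℝ} (hb : 0 < b) (hlam : 0 < lam)
    (hp : ContinuousOn p (Icc 0 b)) (hp0 : ∀ θ ∈ Ioc (0:ℝ) b, 0 < p θ) (hpz : p 0 = 0)
    (hmono : MonotoneOn p (Icc 0 b))
    (hple : ∀ᶠ θ in nhdsWithin (0:ℝ) (Ioi 0), 0 < p θ ∧ p θ ≤ 2 * θ)
    (hUc : ContinuousOn U (Icc 0 b))
    (hU : ∀ θ ∈ Ioo (0:ℝ) b, HasDerivAt U (u' θ) θ)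
    (hG : ∀ θ ∈ Ioo (0:ℝ) b, HasDerivAt (fun θ => p θ * u' θ) (-lam * p θ * U θ) θ)
    (hpos : ∀ θ ∈ Ico (0:ℝ) b, 0 < U θ) :
    ∃ V : ℝ → ℝ, (∀ θ ∈ Icc (0:ℝ) b, HasDerivWithinAt U (V θ) (Icc 0 b) θ) ∧
      ContinuousOn V (Icc 0 b) ∧
      (∀ θ ∈ Ioo (0:ℝ) b, HasDerivAt (fun θ => p θ * V θ) (-lam * p θ * U θ) θ) ∧
      V 0 = 0 ∧ V b ≠ 0 := by
  have hpU : ContinuousOn (fun θ => p θ * U θ) (Icc 0 b) := hp.mul hUc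
  have hint := hpU.intervalIntegrable_of_Icc (μ := MeasureTheory.volume) hb.le
  set G : ℝ → ℝ := fun θ => -lam * ∫ x in (0:ℝ)..θ, p x * U x with hGdef
  have hGc : ContinuousOn G (Icc 0 b) := by
    have := intervalIntegral.continuousOn_primitive_interval (a := 0) (b := b)
      (μ := MeasureTheory.volume) (f := fun θ => p θ * U θ)
      (by rw [uIcc_of_le hb.le]; exact hpU.integrableOn_Icc)
    rw [uIcc_of_le hb.le] at this
    exact continuousOn_const.mul this
  have hGd : ∀ θ ∈ Ioo (0:ℝ) b, HasDerivAt G (-lam * p θ * U θ) θ := by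
    intro θ hθ
    have hn : Icc 0 b ∈ nhds θ := Icc_mem_nhds hθ.1 hθ.2
    have h1 : IntervalIntegrable (fun θ => p θ * U θ) MeasureTheory.volume 0 θ :=
      (hpU.mono (Icc_subset_Icc le_rfl hθ.2.le)).intervalIntegrable_of_Icc hθ.1.le
    have h2 := intervalIntegral.integral_hasDerivAt_right h1
      (ContinuousOn.stronglyMeasurableAtFilter isOpen_Ioo (hpU.mono Ioo_subset_Icc_self) θ hθ)
      (hpU.continuousAt hn)
    exact (h2.const_mul (-lam)).congr_deriv (by ring)
  have hG0 : G 0 = 0 := by simp [hGdef]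
  -- the difference is constant
  obtain ⟨k, hk⟩ := isOpen_Ioo.exists_is_const_of_deriv_eq_zero (s := Ioo (0:ℝ) b)
    (f := fun θ => p θ * u' θ - G θ) isPreconnected_Ioo
    (fun θ hθ => ((hG θ hθ).sub (hGd θ hθ)).differentiableAt.differentiableWithinAt)
    (fun θ hθ => by
      have := ((hG θ hθ).sub (hGd θ hθ)).deriv
      simp only [sub_self] at this
      exact this)
  have hIoo : Ioo 0 b ∈ nhdsWithin (0:ℝ) (Ioi 0) := Ioo_mem_nhdsGT hb
  have hG0lim : Tendsto G (nhdsWithin 0 (Ioi 0)) (nhds 0) := by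
    have := (hGc 0 ⟨le_rfl, hb.le⟩).tendsto
    rw [nhdsWithin_Icc_eq_nhdsGE hb, hG0] at this
    exact this.mono_left (nhdsWithin_mono _ Ioi_subset_Ici_self)
  have hk0 : k = 0 := by
    refine no_sing (p := p) hb hUc hU ?_ hple
    have : Tendsto (fun θ => G θ + k) (nhdsWithin 0 (Ioi 0)) (nhds (0 + k)) :=
      hG0lim.add_const k
    rw [zero_add] at this
    refine this.congr' ?_
    filter_upwards [hIoo] with θ hθ
    have := hk θ hθ
    linarith
  subst hk0
  have hVeq : ∀ θ ∈ Ioo (0:ℝ) b, G θ / p θ = u' θ := by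
    intro θ hθ
    have h1 := hk θ hθ
    have h2 := hp0 θ ⟨hθ.1, hθ.2.le⟩
    rw [div_eq_iff h2.ne']
    linarith
  obtain ⟨M, hM⟩ := isCompact_Icc.exists_bound_of_continuousOn hUc
  have hM0 : 0 ≤ M := (norm_nonneg _).trans (hM 0 ⟨le_rfl, hb.le⟩)
  have hbound : ∀ θ ∈ Icc (0:ℝ) b, |G θ / p θ| ≤ lam * M * θ := by
    intro θ hθ
    rcases hθ.1.eq_or_lt with h | h
    · subst h; simp [hG0]
    have hpp := hp0 θ ⟨h, hθ.2⟩
    rw [abs_div, abs_of_pos hpp, div_le_iff₀ hpp]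
    have := intervalIntegral.norm_integral_le_of_norm_le_const (a := 0) (b := θ)
      (f := fun x => p x * U x) (C := p θ * M) (by
        intro x hx
        rw [uIoc_of_le h.le] at hx
        have hx' : x ∈ Icc 0 b := ⟨hx.1.le, hx.2.trans hθ.2⟩
        rw [norm_mul, Real.norm_of_nonneg (hp0 x ⟨hx.1, hx'.2⟩).le]
        exact mul_le_mul (hmono hx' hθ hx.2) (hM x hx') (norm_nonneg _) hpp.le)
    rw [sub_zero, abs_of_pos h, Real.norm_eq_abs] at this
    simp only [hGdef]
    rw [abs_mul, abs_neg, abs_of_pos hlam]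
    calc _ ≤ lam * (p θ * M * θ) := mul_le_mul_of_nonneg_left this hlam.le
      _ = _ := by ring
  have hVc : ContinuousOn (fun θ => G θ / p θ) (Icc 0 b) := by
    intro θ hθ
    rcases hθ.1.eq_or_lt with h | h
    · subst h
      rw [ContinuousWithinAt]
      simp only [hG0, zero_div]
      refine squeeze_zero_norm' (a := fun θ => lam * M * θ) ?_ ?_
      · filter_upwards [self_mem_nhdsWithin] with x hx using hbound x hx
      · have : Tendsto (fun θ : ℝ => lam * M * θ) (nhds 0) (nhds (lam * M * 0)) :=
          tendsto_id.const_mul _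
        rw [mul_zero] at this
        exact this.mono_left nhdsWithin_le_nhds
    · exact (hGc θ hθ).div (hp θ hθ) (hp0 θ ⟨h, hθ.2⟩).ne'
  have hdiff : DifferentiableOn ℝ U (Ioo 0 b) :=
    fun θ hθ => (hU θ hθ).differentiableAt.differentiableWithinAt
  refine ⟨fun θ => G θ / p θ, ?_, hVc, ?_, by simp [hG0], ?_⟩
  · intro θ hθ
    rcases hθ.1.eq_or_lt with h | h
    · subst h
      refine (hasDerivWithinAt_Ici_of_tendsto_deriv hdiff
        ((hUc 0 hθ).mono Ioo_subset_Icc_self) hIoo ?_).mono Icc_subset_Ici_self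
      have h1 := (hVc 0 hθ).tendsto
      rw [nhdsWithin_Icc_eq_nhdsGE hb] at h1
      refine (h1.mono_left (nhdsWithin_mono _ Ioi_subset_Ici_self)).congr' ?_
      filter_upwards [hIoo] with x hx
      rw [(hU x hx).deriv, hVeq x hx]
    rcases hθ.2.eq_or_lt with h' | h'
    · subst h'
      have hI : Ioo 0 θ ∈ nhdsWithin θ (Iio θ) := Ioo_mem_nhdsLT h
      refine (hasDerivWithinAt_Iic_of_tendsto_deriv hdiff
        ((hUc θ hθ).mono Ioo_subset_Icc_self) hI ?_).mono Icc_subset_Iic_self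
      have h1 := (hVc θ hθ).tendsto
      rw [nhdsWithin_Icc_eq_nhdsLE h] at h1
      refine (h1.mono_left (nhdsWithin_mono _ Iio_subset_Iic_self)).congr' ?_
      filter_upwards [hI] with x hx
      rw [(hU x hx).deriv, hVeq x hx]
    · simp only [hVeq θ ⟨h, h'⟩]
      exact (hU θ ⟨h, h'⟩).hasDerivWithinAt
  · intro θ hθ
    refine (hGd θ hθ).congr_of_eventuallyEq ?_
    filter_upwards [Ioo_mem_nhds hθ.1 hθ.2] with x hx
    have := (hp0 x ⟨hx.1, hx.2.le⟩).ne'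
    field_simp
  · have h1 : 0 < ∫ x in (0:ℝ)..b, p x * U x :=
      intervalIntegral.intervalIntegral_pos_of_pos_on hint
        (fun x hx => mul_pos (hp0 x ⟨hx.1, hx.2.le⟩) (hpos x ⟨hx.1.le, hx.2⟩)) hb
    have h2 := hp0 b ⟨hb, le_rfl⟩
    refine div_ne_zero ?_ h2.ne'
    simp only [hGdef]
    exact mul_ne_zero (by linarith) h1.ne'

theorem denom_pos {p w : ℝ → ℝ} {b : ℝ} (hb : 0 < b)
    (hp : ContinuousOn p (Icc 0 b)) (hp0 : ∀ θ ∈ Ioc (0:ℝ) b, 0 < p θ) (hpz : p 0 = 0)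
    (hw : ContinuousOn w (Icc 0 b)) (hne : ∃ θ ∈ Icc (0:ℝ) b, w θ ≠ 0) :
    0 < ∫ θ in (0:ℝ)..b, w θ ^ 2 * p θ := by
  have hpn : ∀ θ ∈ Icc (0:ℝ) b, 0 ≤ p θ := by
    intro θ hθ
    rcases hθ.1.eq_or_lt with h | h
    · subst h; exact hpz.ge
    · exact (hp0 θ ⟨h, hθ.2⟩).le
  obtain ⟨x, hx, hx'⟩ : ∃ x ∈ Ioo (0:ℝ) b, w x ≠ 0 := by
    by_contra! hcon
    obtain ⟨θ, hθ, hθ'⟩ := hne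
    have h1 : EqOn w 0 (Ioo 0 b) := hcon
    have h2 := h1.of_subset_closure hw continuousOn_const Ioo_subset_Icc_self
      (by rw [closure_Ioo hb.ne])
    exact hθ' (h2 hθ)
  refine intervalIntegral.integral_pos hb ((hw.pow 2).mul hp) ?_ ⟨x, Ioo_subset_Icc_self hx, ?_⟩
  · intro t ht
    exact mul_nonneg (sq_nonneg _) (hpn t (Ioc_subset_Icc_self ht))
  · have := hp0 x ⟨hx.1, hx.2.le⟩
    positivity

theorem sinh_eventually {n : ℝ} (hn : 2 < n) : ∀ᶠ θ in nhdsWithin (0:ℝ) (Ioi 0),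
    0 < Real.sinh θ ^ (n - 1) ∧ Real.sinh θ ^ (n - 1) ≤ 2 * θ := by
  have h1 := (Real.hasDerivAt_sinh 0).tendsto_slope.mono_left (nhdsGT_le_nhdsNE 0)
  have e1 := h1.eventually (gt_mem_nhds (show Real.cosh 0 < 2 by simp))
  have e2 : ∀ᶠ θ in nhdsWithin (0:ℝ) (Ioi 0), Real.sinh θ < 1 :=
    (Real.continuous_sinh.tendsto 0).mono_left nhdsWithin_le_nhds |>.eventually
      (gt_mem_nhds (by simp))
  filter_upwards [e1, e2, self_mem_nhdsWithin] with x hx1 hx2 hx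
  have hx0 : 0 < x := hx
  have hs : 0 < Real.sinh x := Real.sinh_pos_iff.2 hx0
  refine ⟨Real.rpow_pos_of_pos hs _, ?_⟩
  simp only [slope_def_field, Real.sinh_zero, sub_zero] at hx1
  rw [div_lt_iff₀ hx0] at hx1
  have : Real.sinh x ^ (n - 1) ≤ Real.sinh x ^ (1:ℝ) :=
    Real.rpow_le_rpow_of_exponent_ge hs hx2.le (by linarith)
  rw [Real.rpow_one] at this
  linarith

theorem core {n b lam : ℝ} {U u' : ℝ → ℝ} (hn : 2 < n) (hb : 0 < b) (hlam : 0 < lam)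
    (hUc : ContinuousOn U (Icc 0 b))
    (hU : ∀ θ ∈ Ioo (0:ℝ) b, HasDerivAt U (u' θ) θ)
    (hG : ∀ θ ∈ Ioo (0:ℝ) b, HasDerivAt (fun θ => Real.sinh θ ^ (n - 1) * u' θ)
      (-lam * Real.sinh θ ^ (n - 1) * U θ) θ)
    (hpos : ∀ θ ∈ Ico (0:ℝ) b, 0 < U θ) (hUb : U b = 0) :
    lambda1 n b = lam := by
  set p : ℝ → ℝ := fun θ => Real.sinh θ ^ (n - 1) with hpdef
  have hp : ContinuousOn p (Icc 0 b) :=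
    (Real.continuous_sinh.rpow_const (fun _ => Or.inr (by linarith))).continuousOn
  have hp0 : ∀ θ ∈ Ioc (0:ℝ) b, 0 < p θ :=
    fun θ hθ => Real.rpow_pos_of_pos (Real.sinh_pos_iff.2 hθ.1) _
  have hpz : p 0 = 0 := by
    simp only [hpdef, Real.sinh_zero]
    exact Real.zero_rpow (by linarith)
  have hpn : ∀ θ ∈ Icc (0:ℝ) b, 0 ≤ p θ :=
    fun θ hθ => Real.rpow_nonneg (Real.sinh_nonneg_iff.2 hθ.1) _
  have hmono : MonotoneOn p (Icc 0 b) := fun x hx y _ hxy =>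
    Real.rpow_le_rpow (Real.sinh_nonneg_iff.2 hx.1) (Real.sinh_le_sinh.2 hxy) (by linarith)
  obtain ⟨V, hV, hVc, hVG, hV0, hVb⟩ := regularity hb hlam hp hp0 hpz hmono
    (sinh_eventually hn) hUc hU hG hpos
  have hud : UniqueDiffOn ℝ (Icc 0 b) := uniqueDiffOn_Icc hb
  have hVd : EqOn (derivWithin U (Icc 0 b)) V (Icc 0 b) :=
    fun θ hθ => (hV θ hθ).derivWithin (hud θ hθ)
  have hne : ∃ θ ∈ Icc (0:ℝ) b, U θ ≠ 0 :=
    ⟨0, ⟨le_rfl, hb.le⟩, (hpos 0 ⟨le_rfl, hb⟩).ne'⟩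
  refine IsLeast.csInf_eq ⟨⟨U, ?_, hne, hUb, ?_⟩, ?_⟩
  · rw [contDiffOn_one_iff_derivWithin hud]
    exact ⟨fun θ hθ => (hV θ hθ).differentiableWithinAt, hVc.congr hVd⟩
  · have h1 : (∫ θ in (0:ℝ)..b, derivWithin U (Icc 0 b) θ ^ 2 * Real.sinh θ ^ (n - 1))
        = ∫ θ in (0:ℝ)..b, V θ ^ 2 * p θ := by
      refine intervalIntegral.integral_congr fun θ hθ => ?_
      rw [uIcc_of_le hb.le] at hθ
      simp only [hVd hθ, hpdef]
    rw [h1, ← eigen_eq hb hp hV hVc hVG hV0 hUb]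
    have := denom_pos hb hp hp0 hpz hUc hne
    exact (mul_div_cancel_right₀ _ this.ne').symm
  · rintro q ⟨w, hw, hwne, hwb, rfl⟩
    have hw2 := (contDiffOn_one_iff_derivWithin hud).1 hw
    have hd := denom_pos hb hp hp0 hpz hw.continuousOn hwne
    rw [le_div_iff₀ hd]
    exact picone hb hp hpn hV hVc hVG hV0 hpos hUb hVb
      (fun θ hθ => (hw2.1 θ hθ).hasDerivWithinAt) hw2.2 hwb

/-- Lemma 2.2: if `y(θ) = P_ℓ^α(cosh θ)` (encoded by the `LegendreSol`
hypothesis with the limit exponent `α`) is positive on `(0,θ1)` and vanishes at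
`θ1`, with `L1 = -ℓ(ℓ+1) > 0`, then the first Dirichlet eigenvalue is
`λ1 = n(n-2)/4 + L1`. -/
theorem first_eigenvalue_eq (n θ1 α L1 : ℝ)
    (hn2 : 2 < n) (hn4 : n < 4) (hθ1 : 0 < θ1)
    (hα : α = (2 - n) / 2) (hL1 : 0 < L1)
    (hsol : LegendreSol θ1 α L1 α) :
    lambda1 n θ1 = n * (n - 2) / 4 + L1 := by
  obtain ⟨y, y', y'', hyc, hy, hy', hode, hpos, hyb, c, hc, hlim⟩ := hsol
  have hlam : 0 < n * (n - 2) / 4 + L1 := by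
    have : 0 < n * (n - 2) := mul_pos (by linarith) (by linarith)
    linarith
  have hs : ∀ θ : ℝ, 0 < θ → 0 < Real.sinh θ := fun θ h => Real.sinh_pos_iff.2 h
  refine core (U := fun θ => if θ ≤ 0 then c else Real.sinh θ ^ α * y θ)
    (u' := fun θ => Real.cosh θ * α * Real.sinh θ ^ (α - 1) * y θ + Real.sinh θ ^ α * y' θ)
    hn2 hθ1 hlam ?_ ?_ ?_ ?_ ?_
  · intro θ hθ
    rcases hθ.1.eq_or_lt with h | h
    · subst h
      rw [← continuousWithinAt_sdiff_self, ContinuousWithinAt]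
      simp only [le_refl, if_true]
      have h1 : Tendsto (fun θ => (Real.sinh θ / θ) ^ α * (θ ^ α * y θ))
          (nhdsWithin 0 (Ioi 0)) (nhds ((1:ℝ) ^ α * c)) := by
        refine Tendsto.mul (Tendsto.rpow_const ?_ (Or.inl one_ne_zero)) hlim
        have h1 := (Real.hasDerivAt_sinh 0).tendsto_slope.mono_left (nhdsGT_le_nhdsNE 0)
        rw [Real.cosh_zero] at h1
        refine h1.congr fun x => ?_
        simp [slope_def_field]
      rw [Real.one_rpow, one_mul] at h1
      refine (h1.mono_left (nhdsWithin_mono 0 (t := Ioi 0) ?_)).congr' ?_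
      · intro x hx
        exact lt_of_le_of_ne hx.1.1 (Ne.symm hx.2)
      · filter_upwards [self_mem_nhdsWithin] with x hx
        have hx0 : 0 < x := lt_of_le_of_ne hx.1.1 (Ne.symm hx.2)
        rw [if_neg (not_le.2 hx0), Real.div_rpow (hs x hx0).le hx0.le]
        have := (Real.rpow_pos_of_pos hx0 α).ne'
        field_simp
    · have h1 : ContinuousWithinAt (fun θ => Real.sinh θ ^ α * y θ) (Ioc 0 θ1) θ :=
        (Real.continuous_sinh.continuousAt.rpow_const
          (Or.inl (hs θ h).ne')).continuousWithinAt.mul (hyc θ ⟨h, hθ.2⟩)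
      have h2 : ContinuousWithinAt (fun θ => Real.sinh θ ^ α * y θ) (Icc 0 θ1) θ := by
        refine h1.mono_of_mem_nhdsWithin ?_
        filter_upwards [self_mem_nhdsWithin, mem_nhdsWithin_of_mem_nhds (lt_mem_nhds h)]
          with x hx hx' using ⟨hx', hx.2⟩
      refine h2.congr_of_eventuallyEq ?_ (if_neg (not_le.2 h))
      filter_upwards [mem_nhdsWithin_of_mem_nhds (lt_mem_nhds h)] with x hx
      exact if_neg (not_le.2 hx)
  · intro θ hθ
    have h1 := ((Real.hasDerivAt_sinh θ).rpow_const (p := α) (Or.inl (hs θ hθ.1).ne')).mul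
      (hy θ hθ)
    refine h1.congr_of_eventuallyEq ?_
    filter_upwards [lt_mem_nhds hθ.1] with x hx
    exact if_neg (not_le.2 hx)
  · intro θ hθ
    have hsθ := hs θ hθ.1
    have hr : ∀ e : ℝ, HasDerivAt (fun θ => Real.sinh θ ^ e)
        (Real.cosh θ * e * Real.sinh θ ^ (e - 1)) θ := fun e =>
      (Real.hasDerivAt_sinh θ).rpow_const (p := e) (Or.inl hsθ.ne')
    have h1 := (hr (n - 1)).mul (((((Real.hasDerivAt_cosh θ).mul_const α).mul (hr (α - 1))).mul
      (hy θ hθ)).add ((hr α).mul (hy' θ hθ)))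
    refine h1.congr_deriv ?_
    simp only [if_neg (not_le.2 hθ.1), Pi.mul_apply, Pi.add_apply]
    have ho := hode θ hθ
    rw [Real.coth] at ho
    have hy2 : y'' θ = - (Real.cosh θ / Real.sinh θ * y' θ) -
      (L1 - α ^ 2 / Real.sinh θ ^ 2) * y θ := by linarith
    rw [hy2, Real.rpow_sub_one hsθ.ne' (α - 1), Real.rpow_sub_one hsθ.ne' α,
      Real.rpow_sub_one hsθ.ne' (n - 1)]
    have hn : n = 2 - 2 * α := by linarith
    have hcs := Real.cosh_sq θ
    generalize Real.sinh θ ^ (n - 1) = P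
    generalize Real.sinh θ ^ α = A
    rw [hn]
    field_simp
    ring_nf
    rw [hcs]
    ring
  · intro θ hθ
    split_ifs with h
    · exact hc
    · push Not at h
      exact mul_pos (Real.rpow_pos_of_pos (hs θ h) _) (hpos θ ⟨h, hθ.2⟩)
  · simp only [if_neg (not_le.2 hθ1), hyb, mul_zero]

end
end

section
/- Let n be a real parameter with 2 < n < 4, let 0 < R < 1, and let ρ(r) = 2/(1−r²). Set S_n = π·n·(n−2)·(Γ(n/2)/Γ(n))^{2/n} and ω_n = 2·π^{n/2}/Γ(n/2). Let μ = inf { (∫_0^R φ'(r)²·r^{3−n} dr) / (∫_0^R φ(r)²·r^{3−n}·ρ(r)² dr) : φ ∈ C¹([0,R]), φ not identically 0, φ(R) = 0 }. Then for every λ > n(n−2)/4 + μ there exists a continuously differentiable function u : [0,R] → ℝ with u ≥ 0, u not identically 0, u(R) = 0, such that ω_n^{2/n} · ( ∫_0^R u'(r)²·ρ(r)^{n−2}·r^{n−1} dr − λ·∫_0^R u(r)²·ρ(r)^{n}·r^{n−1} dr ) < S_n · ( ∫_0^R u(r)^{2n/(n−2)}·ρ(r)^{n}·r^{n−1} dr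 )^{(n−2)/n}. -/
open Real Set

noncomputable section

lemma beta_real (s : ℝ) (hs : 0 < s) :
    ∫ t in (0:ℝ)..1, t ^ (s - 1) * (1 - t) ^ (s - 1) = Real.Gamma s ^ 2 / Real.Gamma (s + s) := by
  have h := ProbabilityTheory.beta_eq_betaIntegralReal s s hs hs
  have h2 : Complex.betaIntegral s s
      = ((∫ t in (0:ℝ)..1, t ^ (s - 1) * (1 - t) ^ (s - 1) : ℝ) : ℂ) := by
    rw [Complex.betaIntegral, ← intervalIntegral.integral_ofReal]
    apply intervalIntegral.integral_congr
    intro t ht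
    rw [uIcc_of_le zero_le_one] at ht
    have h1 : (0:ℝ) ≤ 1 - t := by linarith [ht.2]
    push_cast [Complex.ofReal_cpow ht.1, Complex.ofReal_cpow h1]
    rfl
  rw [h2, Complex.ofReal_re] at h
  rw [← h, ProbabilityTheory.beta, sq]

lemma bubble_mass (n R e : ℝ) (hn : 2 < n) (hR : 0 < R) (he : 0 < e) :
    ∫ r in (0:ℝ)..R, (e + r ^ 2) ^ (-n) * r ^ (n - 1) ≤
      e ^ (-(n / 2)) * (Real.Gamma (n / 2) ^ 2 / (2 * Real.Gamma n)) := by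
  have hY : ∀ r : ℝ, 0 < e + r ^ 2 := fun r => by positivity
  have hsub := intervalIntegral.integral_comp_mul_deriv'' (a := 0) (b := R)
    (f := fun r => r ^ 2 / (e + r ^ 2)) (f' := fun r => 2 * r * e / (e + r ^ 2) ^ 2)
    (g := fun t => t ^ (n / 2 - 1) * (1 - t) ^ (n / 2 - 1))
    (by
      apply Continuous.continuousOn
      exact Continuous.div (by fun_prop) (by fun_prop) (fun r => (hY r).ne'))
    (by
      intro x _
      have := ((hasDerivAt_pow 2 x).div ((hasDerivAt_pow 2 x).const_add e) (hY x).ne')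
      refine (this.congr_deriv ?_).hasDerivWithinAt
      congr 1
      push_cast
      ring)
    (by
      apply Continuous.continuousOn
      exact Continuous.div (by fun_prop) (by fun_prop) (fun r => (pow_pos (hY r) 2).ne'))
    (by
      apply Continuous.continuousOn
      refine Continuous.mul ?_ ?_
      · exact Continuous.rpow_const continuous_id (fun x => Or.inr (by linarith))
      · exact Continuous.rpow_const (by fun_prop) (fun x => Or.inr (by linarith)))
  have hcongr : ∫ r in (0:ℝ)..R, (e + r ^ 2) ^ (-n) * r ^ (n - 1) =
      ∫ r in (0:ℝ)..R, (e ^ (-(n / 2)) / 2) *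
        (((fun t : ℝ => t ^ (n / 2 - 1) * (1 - t) ^ (n / 2 - 1)) ∘
          (fun r => r ^ 2 / (e + r ^ 2))) r * (2 * r * e / (e + r ^ 2) ^ 2)) := by
    apply intervalIntegral.integral_congr
    intro r hr
    rw [uIcc_of_le hR.le] at hr
    have hr0 := hr.1
    have hY' := hY r
    have h1 : 1 - r ^ 2 / (e + r ^ 2) = e / (e + r ^ 2) := by field_simp; ring
    simp only [Function.comp, h1]
    rw [div_rpow (by positivity) hY'.le, div_rpow he.le hY'.le]
    have h2 : (r ^ 2) ^ (n / 2 - 1) * r = r ^ (n - 1) := by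
      rw [← rpow_natCast r 2, ← rpow_mul hr0]
      rcases hr0.eq_or_lt with h | h
      · rw [← h, mul_zero, zero_rpow (by linarith)]
      · nth_rw 2 [← rpow_one r]
        rw [← rpow_add h]; congr 1; push_cast; ring
    have h3 : e ^ (-(n / 2)) * (e ^ (n / 2 - 1) * e) = 1 := by
      nth_rw 3 [← rpow_one e]
      rw [← rpow_add he, ← rpow_add he]; ring_nf; simp
    have h4 : ∀ y : ℝ, 0 < y → y ^ (-n) * (y ^ (n / 2 - 1)) ^ 2 * y ^ 2 = 1 := by
      intro y hy
      rw [← rpow_natCast (y ^ (n / 2 - 1)) 2, ← rpow_natCast y 2, ← rpow_mul hy.le, ← rpow_add hy,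
        ← rpow_add hy]
      rw [show -n + (n / 2 - 1) * ((2:ℕ):ℝ) + ((2:ℕ):ℝ) = 0 by push_cast; ring, rpow_zero]
    have h5 : 0 < (e + r ^ 2) ^ (n / 2 - 1) := rpow_pos_of_pos hY' _
    have h4' := h4 _ hY'
    rw [← h2]
    generalize (e + r ^ 2) ^ (n / 2 - 1) = q at *
    generalize (e + r ^ 2) ^ (-n) = q' at *
    generalize (r ^ 2) ^ (n / 2 - 1) = z at *
    generalize e ^ (n / 2 - 1) = w at *
    generalize e ^ (-(n / 2)) = w' at *
    generalize e + r ^ 2 = y at *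
    field_simp
    linear_combination (r * z) * h4' - r * z * h3
  rw [hcongr, intervalIntegral.integral_const_mul, hsub]
  have hT1 : R ^ 2 / (e + R ^ 2) ≤ 1 := by rw [div_le_one (hY R)]; linarith
  have hT0 : 0 ≤ R ^ 2 / (e + R ^ 2) := by positivity
  have hb := beta_real (n / 2) (by linarith)
  have hle : ∫ t in (0 ^ 2 / (e + 0 ^ 2))..(R ^ 2 / (e + R ^ 2)),
      t ^ (n / 2 - 1) * (1 - t) ^ (n / 2 - 1) ≤
      ∫ t in (0:ℝ)..1, t ^ (n / 2 - 1) * (1 - t) ^ (n / 2 - 1) := by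
    have hcont : Continuous (fun t : ℝ => t ^ (n / 2 - 1) * (1 - t) ^ (n / 2 - 1)) := by
      refine Continuous.mul ?_ ?_
      · exact Continuous.rpow_const continuous_id (fun x => Or.inr (by linarith))
      · exact Continuous.rpow_const (by fun_prop) (fun x => Or.inr (by linarith))
    have h0 : (0:ℝ) ^ 2 / (e + 0 ^ 2) = 0 := by simp
    rw [h0]
    apply intervalIntegral.integral_mono_interval le_rfl hT0 hT1
    · refine (MeasureTheory.ae_restrict_iff' measurableSet_Ioc).2 (Filter.Eventually.of_forall ?_)
      intro t ht
      exact mul_nonneg (rpow_nonneg ht.1.le _) (rpow_nonneg (by linarith [ht.2]) _)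
    · exact hcont.intervalIntegrable _ _
  rw [hb, add_halves] at hle
  have hep : 0 < e ^ (-(n / 2)) / 2 := by positivity
  calc _ ≤ e ^ (-(n / 2)) / 2 * (Real.Gamma (n / 2) ^ 2 / Real.Gamma n) :=
        mul_le_mul_of_nonneg_left hle hep.le
    _ = _ := by field_simp

lemma memLp_cont (R : ℝ) (p : ENNReal) (f : ℝ → ℝ) (hf : ContinuousOn f (Icc 0 R)) :
    MeasureTheory.MemLp f p (MeasureTheory.volume.restrict (Ioc 0 R)) := by
  obtain ⟨C, hC⟩ := isCompact_Icc.exists_bound_of_continuousOn hf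
  apply MeasureTheory.MemLp.of_bound
    ((hf.mono Ioc_subset_Icc_self).aestronglyMeasurable measurableSet_Ioc) C
  refine (MeasureTheory.ae_restrict_iff' measurableSet_Ioc).2 (Filter.Eventually.of_forall ?_)
  intro t ht
  exact hC t (Ioc_subset_Icc_self ht)

lemma holder_lem (n R : ℝ) (hn : 2 < n) (hR : 0 < R) (ψ C : ℝ → ℝ)
    (hψ : ContinuousOn ψ (Icc 0 R)) (hC : ContinuousOn C (Icc 0 R))
    (hψ0 : ∀ r ∈ Icc 0 R, 0 ≤ ψ r) (hC0 : ∀ r ∈ Icc 0 R, 0 ≤ C r) :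
    ∫ r in (0:ℝ)..R, ψ r ^ 2 * C r ≤
      (∫ r in (0:ℝ)..R, ψ r ^ (2 * n / (n - 2)) * C r) ^ ((n - 2) / n) *
      (∫ r in (0:ℝ)..R, C r) ^ (2 / n) := by
  have hn0 : 0 < n := by linarith
  have hn2 : 0 < n - 2 := by linarith
  have hpq : (n / (n - 2)).HolderConjugate (n / 2) := by
    rw [Real.holderConjugate_iff]
    constructor
    · rw [lt_div_iff₀ hn2]; linarith
    · field_simp; ring
  have hae : ∀ f : ℝ → ℝ, (∀ r ∈ Icc 0 R, 0 ≤ f r) →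
      0 ≤ᵐ[MeasureTheory.volume.restrict (Ioc 0 R)] f := by
    intro f hf
    refine (MeasureTheory.ae_restrict_iff' measurableSet_Ioc).2 (Filter.Eventually.of_forall ?_)
    intro t ht
    exact hf t (Ioc_subset_Icc_self ht)
  have key := MeasureTheory.integral_mul_le_Lp_mul_Lq_of_nonneg hpq
    (μ := MeasureTheory.volume.restrict (Ioc 0 R))
    (f := fun r => ψ r ^ 2 * C r ^ ((n - 2) / n)) (g := fun r => C r ^ (2 / n))
    (hae _ (fun r hr => mul_nonneg (sq_nonneg _) (rpow_nonneg (hC0 r hr) _)))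
    (hae _ (fun r hr => rpow_nonneg (hC0 r hr) _))
    (memLp_cont _ _ _ ((hψ.pow 2).mul (hC.rpow_const (fun x _ => Or.inr (by positivity)))))
    (memLp_cont _ _ _ (hC.rpow_const (fun x _ => Or.inr (by positivity))))
  simp only [intervalIntegral.integral_of_le hR.le]
  have e1 : ∫ r in Ioc 0 R, ψ r ^ 2 * C r ^ ((n - 2) / n) * C r ^ (2 / n) =
      ∫ r in Ioc 0 R, ψ r ^ 2 * C r := by
    apply MeasureTheory.setIntegral_congr_fun measurableSet_Ioc
    intro r hr
    have hc := hC0 r (Ioc_subset_Icc_self hr)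
    simp only
    rw [mul_assoc, ← rpow_add_of_nonneg hc (by positivity) (by positivity)]
    rw [show (n - 2) / n + 2 / n = 1 by field_simp; ring, rpow_one]
  have e2 : ∫ r in Ioc 0 R, (ψ r ^ 2 * C r ^ ((n - 2) / n)) ^ (n / (n - 2)) =
      ∫ r in Ioc 0 R, ψ r ^ (2 * n / (n - 2)) * C r := by
    apply MeasureTheory.setIntegral_congr_fun measurableSet_Ioc
    intro r hr
    have hc := hC0 r (Ioc_subset_Icc_self hr)
    have hp := hψ0 r (Ioc_subset_Icc_self hr)
    simp only
    rw [mul_rpow (sq_nonneg _) (rpow_nonneg hc _), ← rpow_mul hc, ← rpow_natCast (ψ r) 2,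
      ← rpow_mul hp]
    rw [show (n - 2) / n * (n / (n - 2)) = 1 by field_simp, rpow_one]
    congr 2
    push_cast; ring
  have e3 : ∫ r in Ioc 0 R, (C r ^ (2 / n)) ^ (n / 2) = ∫ r in Ioc 0 R, C r := by
    apply MeasureTheory.setIntegral_congr_fun measurableSet_Ioc
    intro r hr
    have hc := hC0 r (Ioc_subset_Icc_self hr)
    simp only
    rw [← rpow_mul hc, show 2 / n * (n / 2) = 1 by field_simp, rpow_one]
  rw [e1, e2, e3] at key
  rwa [one_div_div, one_div_div] at key

/-- bubble weight `w^{2*} r^{n-1}` -/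
def Cw (n e r : ℝ) : ℝ := (e + r ^ 2) ^ (-n) * r ^ (n - 1)

/-- bubble weight `w^2 r^{n-1}` -/
def Aw (n e r : ℝ) : ℝ := (e + r ^ 2) ^ 2 * Cw n e r

lemma Cw_cont (n e : ℝ) (hn : 2 < n) (he : 0 < e) : Continuous (Cw n e) := by
  unfold Cw
  refine Continuous.mul ?_ ?_
  · exact Continuous.rpow_const (by fun_prop) (fun x => Or.inl (by positivity))
  · exact Continuous.rpow_const continuous_id (fun x => Or.inr (by linarith))

lemma Aw_cont (n e : ℝ) (hn : 2 < n) (he : 0 < e) : Continuous (Aw n e) := by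
  have := Cw_cont n e hn he
  unfold Aw
  fun_prop

lemma Cw_nonneg (n e r : ℝ) (he : 0 ≤ e) (hr : 0 ≤ r) : 0 ≤ Cw n e r := by
  unfold Cw; positivity

lemma Aw_nonneg (n e r : ℝ) (he : 0 ≤ e) (hr : 0 ≤ r) : 0 ≤ Aw n e r :=
  mul_nonneg (sq_nonneg _) (Cw_nonneg n e r he hr)

lemma Aw_eq (n e r : ℝ) (he : 0 ≤ e) (hr : 0 < r) :
    Aw n e r = (e + r ^ 2) ^ (2 - n) * r ^ (n - 1) := by
  have hY : 0 < e + r ^ 2 := by positivity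
  unfold Aw Cw
  rw [← mul_assoc, sub_eq_add_neg 2 n, rpow_add hY, rpow_two]

lemma Aw_zero (n r : ℝ) (hr : 0 < r) : Aw n 0 r = r ^ (3 - n) := by
  rw [Aw_eq n 0 r le_rfl hr, zero_add, ← rpow_two, ← rpow_mul hr.le, ← rpow_add hr]
  congr 1; ring

lemma Aw_le (n e r : ℝ) (hn : 2 < n) (he : 0 ≤ e) (hr : 0 < r) : Aw n e r ≤ r ^ (3 - n) := by
  rw [← Aw_zero n r hr, Aw_eq n e r he hr, Aw_eq n 0 r le_rfl hr]
  apply mul_le_mul_of_nonneg_right _ (rpow_nonneg hr.le _)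
  exact rpow_le_rpow_of_nonpos (by positivity) (by linarith) (by linarith)

lemma Aw_lim (n r : ℝ) (hr : 0 < r) :
    Filter.Tendsto (fun ε : ℝ => Aw n (ε ^ 2) r) (nhdsWithin 0 (Ioi 0))
      (nhds (r ^ (3 - n))) := by
  rw [← Aw_zero n r hr]
  have : ContinuousAt (fun ε : ℝ => Aw n (ε ^ 2) r) 0 := by
    unfold Aw Cw
    refine ContinuousAt.mul (by fun_prop) (ContinuousAt.mul ?_ continuousAt_const)
    exact ContinuousAt.rpow_const (by fun_prop) (Or.inl (by positivity))
  have h := this.tendsto.mono_left (nhdsWithin_le_nhds (s := Ioi 0))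
  simpa using h

lemma Cw_deriv (n e r : ℝ) (he : 0 < e) (hr : 0 < r) :
    HasDerivAt (Cw n e) (Cw n e r * (-2 * n * r / (e + r ^ 2) + (n - 1) / r)) r := by
  have hY : 0 < e + r ^ 2 := by positivity
  have h1 : HasDerivAt (fun r : ℝ => e + r ^ 2) (2 * r) r := by
    simpa using (hasDerivAt_pow 2 r).const_add e
  have h2 := (h1.rpow_const (p := -n) (Or.inl hY.ne')).mul
    (Real.hasDerivAt_rpow_const (x := r) (p := n - 1) (Or.inl hr.ne'))
  refine h2.congr_deriv ?_
  rw [rpow_sub_one hY.ne', rpow_sub_one hr.ne' (n - 1)]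
  unfold Cw
  field_simp

/-- logarithmic derivative of the hyperbolic bubble -/
def Lw (n e r : ℝ) : ℝ := -((n - 2) * (1 + e) * r / ((1 - r ^ 2) * (e + r ^ 2)))

lemma Lw_cont (n e R : ℝ) (he : 0 < e) (hR1 : R < 1) : ContinuousOn (Lw n e) (Icc 0 R) := by
  unfold Lw
  refine (ContinuousOn.div (by fun_prop) (by fun_prop) ?_).neg
  intro r hr
  have : 0 < 1 - r ^ 2 := by nlinarith [hr.1, hr.2]
  positivity

lemma rho_cont (R : ℝ) (hR1 : R < 1) :
    ContinuousOn (fun r : ℝ => 2 / (1 - r ^ 2)) (Icc 0 R) := by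
  refine ContinuousOn.div (by fun_prop) (by fun_prop) ?_
  intro r hr
  have : 0 < 1 - r ^ 2 := by nlinarith [hr.1, hr.2]
  positivity

lemma energy (n R e : ℝ) (hn : 2 < n) (hR0 : 0 < R) (hR1 : R < 1) (he : 0 < e)
    (ψ ψ' : ℝ → ℝ) (hψ : ∀ r ∈ Icc 0 R, HasDerivWithinAt ψ (ψ' r) (Icc 0 R) r)
    (hψ' : ContinuousOn ψ' (Icc 0 R)) (hψR : ψ R = 0) :
    ∫ r in (0:ℝ)..R, (ψ' r + ψ r * Lw n e r) ^ 2 * Aw n e r =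
      (∫ r in (0:ℝ)..R, ψ' r ^ 2 * Aw n e r)
      + n * (n - 2) / 4 * (∫ r in (0:ℝ)..R, ψ r ^ 2 * Aw n e r * (2 / (1 - r ^ 2)) ^ 2)
      + n * (n - 2) * e * ∫ r in (0:ℝ)..R, ψ r ^ 2 * Cw n e r := by
  have hψc : ContinuousOn ψ (Icc 0 R) := fun r hr => (hψ r hr).continuousWithinAt
  have hA := (Aw_cont n e hn he).continuousOn (s := Icc 0 R)
  have hC := (Cw_cont n e hn he).continuousOn (s := Icc 0 R)
  have hL := Lw_cont n e R he hR1
  have hρ := rho_cont R hR1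
  have hi : ∀ f : ℝ → ℝ, ContinuousOn f (Icc 0 R) →
      IntervalIntegrable f MeasureTheory.volume 0 R := fun f hf =>
    ContinuousOn.intervalIntegrable_of_Icc hR0.le hf
  have c1 : ContinuousOn (fun r => ψ' r ^ 2 * Aw n e r) (Icc 0 R) := by fun_prop
  have c2 : ContinuousOn (fun r => ψ r ^ 2 * Aw n e r * (2 / (1 - r ^ 2)) ^ 2) (Icc 0 R) :=
    ContinuousOn.mul (by fun_prop) (hρ.pow 2)
  have c3 : ContinuousOn (fun r => ψ r ^ 2 * Cw n e r) (Icc 0 R) := by fun_prop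
  have c4 : ContinuousOn (fun r => (ψ' r + ψ r * Lw n e r) ^ 2 * Aw n e r) (Icc 0 R) := by
    fun_prop
  have hftc := intervalIntegral.integral_eq_sub_of_hasDerivAt_of_le hR0.le
    (f := fun r => ψ r ^ 2 * (Aw n e r * Lw n e r))
    (f' := fun r => (ψ' r + ψ r * Lw n e r) ^ 2 * Aw n e r - (ψ' r ^ 2 * Aw n e r
      + n * (n - 2) / 4 * (ψ r ^ 2 * Aw n e r * (2 / (1 - r ^ 2)) ^ 2)
      + n * (n - 2) * e * (ψ r ^ 2 * Cw n e r)))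
    (by fun_prop)
    (by
      intro r hr
      have hr0 := hr.1
      have hX : 0 < 1 - r ^ 2 := by nlinarith [hr.1, hr.2]
      have hY : 0 < e + r ^ 2 := by positivity
      have h1 : HasDerivAt ψ (ψ' r) r :=
        (hψ r (Ioo_subset_Icc_self hr)).hasDerivAt (Icc_mem_nhds hr.1 hr.2)
      have hY1 : HasDerivAt (fun r : ℝ => e + r ^ 2) (2 * r) r := by
        simpa using (hasDerivAt_pow 2 r).const_add e
      have hX1 : HasDerivAt (fun r : ℝ => 1 - r ^ 2) (-(2 * r)) r := by
        simpa using (hasDerivAt_pow 2 r).const_sub 1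
      have hCd := Cw_deriv n e r he hr0
      have hAd := (hY1.pow 2).mul hCd
      have hLd := (((hasDerivAt_id r).const_mul ((n - 2) * (1 + e))).div (hX1.mul hY1)
        (by simp only [Pi.mul_apply]; positivity)).neg
      have := (h1.pow 2).mul (hAd.mul hLd)
      refine this.congr_deriv ?_
      simp only [Pi.mul_apply, Pi.pow_apply, Pi.neg_apply, Pi.div_apply, id, Aw, Lw]
      generalize Cw n e r = c
      push_cast
      field_simp
      ring)
    (by
      apply hi
      fun_prop)
  rw [intervalIntegral.integral_sub (hi _ c4)
    (((hi _ c1).add ((hi _ c2).const_mul _)).add ((hi _ c3).const_mul _)),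
    intervalIntegral.integral_add ((hi _ c1).add ((hi _ c2).const_mul _)) ((hi _ c3).const_mul _),
    intervalIntegral.integral_add (hi _ c1) ((hi _ c2).const_mul _),
    intervalIntegral.integral_const_mul, intervalIntegral.integral_const_mul] at hftc
  have z : Lw n e 0 = 0 := by simp [Lw]
  simp only [z, hψR] at hftc
  linarith

/-- hyperbolic bubble -/
def gw (n e r : ℝ) : ℝ := ((1 - r ^ 2) / (2 * (e + r ^ 2))) ^ ((n - 2) / 2)

lemma gw_pos (n e r : ℝ) (he : 0 < e) (hX : 0 < 1 - r ^ 2) : 0 < gw n e r := by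
  unfold gw; positivity

lemma gw_deriv (n e r : ℝ) (he : 0 < e) (hX : 0 < 1 - r ^ 2) :
    HasDerivAt (gw n e) (Lw n e r * gw n e r) r := by
  have hY : 0 < e + r ^ 2 := by positivity
  have hY1 : HasDerivAt (fun r : ℝ => 2 * (e + r ^ 2)) (2 * (2 * r)) r := by
    simpa using ((hasDerivAt_pow 2 r).const_add e).const_mul 2
  have hX1 : HasDerivAt (fun r : ℝ => 1 - r ^ 2) (-(2 * r)) r := by
    simpa using (hasDerivAt_pow 2 r).const_sub 1
  have hq : 0 < (1 - r ^ 2) / (2 * (e + r ^ 2)) := by positivity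
  have := (hX1.div hY1 (by positivity)).rpow_const (p := (n - 2) / 2) (Or.inl hq.ne')
  refine this.congr_deriv ?_
  simp only [Pi.div_apply]
  rw [rpow_sub_one hq.ne']
  unfold gw Lw
  generalize ((1 - r ^ 2) / (2 * (e + r ^ 2))) ^ ((n - 2) / 2) = g
  field_simp
  ring

lemma gw_sq (n e r : ℝ) (he : 0 < e) (hX : 0 < 1 - r ^ 2) :
    gw n e r ^ 2 * (2 / (1 - r ^ 2)) ^ (n - 2) * r ^ (n - 1) = Aw n e r := by
  have hY : 0 < e + r ^ 2 := by positivity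
  have hq : 0 < (1 - r ^ 2) / (2 * (e + r ^ 2)) := by positivity
  have h : gw n e r ^ 2 * (2 / (1 - r ^ 2)) ^ (n - 2) = (e + r ^ 2) ^ (2 - n) := by
    unfold gw
    rw [← rpow_natCast _ 2, ← rpow_mul hq.le, show (n - 2) / 2 * ((2:ℕ):ℝ) = n - 2 by
      push_cast; ring, ← mul_rpow hq.le (by positivity),
      show (1 - r ^ 2) / (2 * (e + r ^ 2)) * (2 / (1 - r ^ 2)) = (e + r ^ 2)⁻¹ by field_simp,
      inv_rpow hY.le, ← rpow_neg hY.le]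
    congr 1; ring
  rw [h]
  unfold Aw Cw
  rw [← mul_assoc, sub_eq_add_neg 2 n, rpow_add hY, rpow_two]

lemma gw_sq' (n e r : ℝ) (he : 0 < e) (hX : 0 < 1 - r ^ 2) :
    gw n e r ^ 2 * (2 / (1 - r ^ 2)) ^ n * r ^ (n - 1) =
      Aw n e r * (2 / (1 - r ^ 2)) ^ 2 := by
  have hp : 0 < 2 / (1 - r ^ 2) := by positivity
  rw [← gw_sq n e r he hX]
  have : (2 / (1 - r ^ 2)) ^ n = (2 / (1 - r ^ 2)) ^ (n - 2) * (2 / (1 - r ^ 2)) ^ 2 := by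
    rw [← rpow_two (2 / (1 - r ^ 2)), ← rpow_add hp]; congr 1; ring
  rw [this]; ring

lemma gw_crit (n e r : ℝ) (hn : 2 < n) (he : 0 < e) (hX : 0 < 1 - r ^ 2) :
    gw n e r ^ (2 * n / (n - 2)) * (2 / (1 - r ^ 2)) ^ n * r ^ (n - 1) = Cw n e r := by
  have hY : 0 < e + r ^ 2 := by positivity
  have hn2 : 0 < n - 2 := by linarith
  have hq : 0 < (1 - r ^ 2) / (2 * (e + r ^ 2)) := by positivity
  unfold Cw gw
  rw [← rpow_mul hq.le, show (n - 2) / 2 * (2 * n / (n - 2)) = n by field_simp,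
    ← mul_rpow hq.le (by positivity),
      show (1 - r ^ 2) / (2 * (e + r ^ 2)) * (2 / (1 - r ^ 2)) = (e + r ^ 2)⁻¹ by field_simp,
      inv_rpow hY.le, ← rpow_neg hY.le]

lemma const_id (n e : ℝ) (hn : 2 < n) (he : 0 < e) :
    (2 * π ^ (n / 2) / Real.Gamma (n / 2)) ^ ((2:ℝ) / n) *
      (n * (n - 2) * e *
        (e ^ (-(n / 2)) * (Real.Gamma (n / 2) ^ 2 / (2 * Real.Gamma n))) ^ ((2:ℝ) / n)) =
    π * n * (n - 2) * (Real.Gamma (n / 2) / Real.Gamma n) ^ ((2:ℝ) / n) := by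
  have h1 : 0 < Real.Gamma (n / 2) := Real.Gamma_pos_of_pos (by linarith)
  have h2 : 0 < Real.Gamma n := Real.Gamma_pos_of_pos (by linarith)
  have hn0 : 0 < n := by linarith
  have hpi := Real.pi_pos
  have e1 : e * (e ^ (-(n / 2))) ^ ((2:ℝ) / n) = 1 := by
    rw [← rpow_mul he.le, show -(n / 2) * (2 / n) = -1 by field_simp, rpow_neg_one]
    field_simp
  have e2 : (π ^ (n / 2)) ^ ((2:ℝ) / n) = π := by
    rw [← rpow_mul hpi.le, show (n / 2) * (2 / n) = 1 by field_simp, rpow_one]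
  have e3 : (2 * π ^ (n / 2) / Real.Gamma (n / 2)) ^ ((2:ℝ) / n) *
      (Real.Gamma (n / 2) ^ 2 / (2 * Real.Gamma n)) ^ ((2:ℝ) / n) =
      π * (Real.Gamma (n / 2) / Real.Gamma n) ^ ((2:ℝ) / n) := by
    rw [← mul_rpow (by positivity) (by positivity)]
    nth_rw 2 [← e2]
    rw [← mul_rpow (by positivity) (by positivity)]
    congr 1
    field_simp
  rw [mul_rpow (by positivity) (by positivity)]
  linear_combination n * (n - 2) * (e * (e ^ (-(n / 2))) ^ ((2:ℝ) / n)) * e3 +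
    n * (n - 2) * π * (Real.Gamma (n / 2) / Real.Gamma n) ^ ((2:ℝ) / n) * e1

/-- smooth nonnegative replacement of `|x|` -/
def sm (ε x : ℝ) : ℝ := √(x ^ 2 + ε ^ 2) - ε

lemma sm_nonneg (ε x : ℝ) (hε : 0 < ε) : 0 ≤ sm ε x := by
  unfold sm
  have : ε ≤ √(x ^ 2 + ε ^ 2) := Real.le_sqrt_of_sq_le (by nlinarith [sq_nonneg x])
  linarith

lemma sm_sq_le (ε x : ℝ) (hε : 0 < ε) : sm ε x ^ 2 ≤ x ^ 2 := by
  have h := sm_nonneg ε x hε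
  unfold sm at *
  have h2 : √(x ^ 2 + ε ^ 2) ^ 2 = x ^ 2 + ε ^ 2 := Real.sq_sqrt (by positivity)
  nlinarith

lemma sm_ne (ε x : ℝ) (hε : 0 < ε) (hx : x ≠ 0) : sm ε x ≠ 0 := by
  unfold sm
  have : ε < √(x ^ 2 + ε ^ 2) := Real.lt_sqrt_of_sq_lt (by have := sq_pos_of_ne_zero hx; linarith)
  linarith

lemma sm_lim (x : ℝ) :
    Filter.Tendsto (fun ε : ℝ => sm ε x ^ 2) (nhdsWithin 0 (Ioi 0)) (nhds (x ^ 2)) := by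
  have : Continuous (fun ε : ℝ => sm ε x ^ 2) := by unfold sm; fun_prop
  have h := (this.tendsto 0).mono_left (nhdsWithin_le_nhds (s := Ioi 0))
  have h0 : sm 0 x ^ 2 = x ^ 2 := by simp [sm, Real.sqrt_sq_eq_abs]
  rwa [h0] at h

lemma wint (n R : ℝ) (hn4 : n < 4) (hR0 : 0 < R)
    (f : ℝ → ℝ) (hf : ContinuousOn f (Icc 0 R)) :
    IntervalIntegrable (fun r => f r * r ^ (3 - n)) MeasureTheory.volume 0 R := by
  apply IntervalIntegrable.continuousOn_mul
  · exact intervalIntegral.intervalIntegrable_rpow' (by linarith)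
  · rwa [uIcc_of_le hR0.le]

lemma denom_pos_s5 (n R : ℝ) (hn4 : n < 4) (hR0 : 0 < R) (hR1 : R < 1) (φ : ℝ → ℝ)
    (hφ : ContinuousOn φ (Icc 0 R)) (hne : ∃ r ∈ Icc (0:ℝ) R, φ r ≠ 0) :
    0 < ∫ r in (0:ℝ)..R, (φ r) ^ 2 * r ^ (3 - n) * (2 / (1 - r ^ 2)) ^ 2 := by
  have hρ := rho_cont R hR1
  have hinteg : IntervalIntegrable (fun r => (φ r) ^ 2 * r ^ (3 - n) * (2 / (1 - r ^ 2)) ^ 2)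
      MeasureTheory.volume 0 R := by
    have := wint n R hn4 hR0 (fun r => φ r ^ 2 * (2 / (1 - r ^ 2)) ^ 2) ((hφ.pow 2).mul (hρ.pow 2))
    refine this.congr ?_
    intro r _
    ring
  obtain ⟨r0, hr0, hne⟩ := hne
  -- a point in the interior
  have hopen : ∃ U : Set ℝ, IsOpen U ∧ r0 ∈ U ∧ ∀ r ∈ U ∩ Icc 0 R, φ r ≠ 0 := by
    have h := (hφ r0 hr0).eventually_ne hne
    rw [eventually_nhdsWithin_iff] at h
    obtain ⟨U, hU, hUo, hrU⟩ := eventually_nhds_iff.1 h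
    exact ⟨U, hUo, hrU, fun r hr => hU r hr.1 hr.2⟩
  obtain ⟨U, hUo, hrU, hU⟩ := hopen
  have hcl : r0 ∈ closure (Ioo 0 R) := by rwa [closure_Ioo hR0.ne]
  have hnon : (U ∩ Ioo 0 R).Nonempty := mem_closure_iff.1 hcl U hUo hrU
  have hpos : 0 < MeasureTheory.volume (U ∩ Ioo 0 R) := (hUo.inter isOpen_Ioo).measure_pos _ hnon
  rw [intervalIntegral.integral_pos_iff_support_of_nonneg_ae' _ hinteg]
  · refine ⟨hR0, hpos.trans_le (MeasureTheory.measure_mono ?_)⟩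
    intro r hr
    refine ⟨?_, Ioo_subset_Ioc_self hr.2⟩
    have h1 := hU r ⟨hr.1, Ioo_subset_Icc_self hr.2⟩
    have h2 : 0 < r := hr.2.1
    have hX : 0 < 1 - r ^ 2 := by nlinarith [hr.2.1, hr.2.2]
    rw [Function.mem_support]
    positivity
  · rw [uIoc_of_le hR0.le]
    refine (MeasureTheory.ae_restrict_iff' measurableSet_Ioc).2 (Filter.Eventually.of_forall ?_)
    intro r hr
    have h2 : 0 < r := hr.1
    simp only [Pi.zero_apply]
    positivity

lemma dct (n R : ℝ) (hn2 : 2 < n) (hn4 : n < 4) (hR0 : 0 < R) (hR1 : R < 1) (φ : ℝ → ℝ)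
    (hφ : ContinuousOn φ (Icc 0 R)) :
    Filter.Tendsto (fun ε : ℝ => ∫ r in (0:ℝ)..R,
        sm ε (φ r) ^ 2 * Aw n (ε ^ 2) r * (2 / (1 - r ^ 2)) ^ 2) (nhdsWithin 0 (Ioi 0))
      (nhds (∫ r in (0:ℝ)..R, (φ r) ^ 2 * r ^ (3 - n) * (2 / (1 - r ^ 2)) ^ 2)) := by
  have hρ := rho_cont R hR1
  have hinteg : IntervalIntegrable (fun r => (φ r) ^ 2 * r ^ (3 - n) * (2 / (1 - r ^ 2)) ^ 2)
      MeasureTheory.volume 0 R := by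
    have := wint n R hn4 hR0 (fun r => φ r ^ 2 * (2 / (1 - r ^ 2)) ^ 2) ((hφ.pow 2).mul (hρ.pow 2))
    refine this.congr ?_
    intro r _
    ring
  apply intervalIntegral.tendsto_integral_filter_of_dominated_convergence _ _ _ hinteg
  · refine Filter.Eventually.of_forall ?_
    intro r hr
    rw [uIoc_of_le hR0.le] at hr
    exact ((sm_lim (φ r)).mul (Aw_lim n r hr.1)).mul_const _
  · filter_upwards [self_mem_nhdsWithin] with ε hε
    rw [uIoc_of_le hR0.le]
    apply ContinuousOn.aestronglyMeasurable _ measurableSet_Ioc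
    have hA := (Aw_cont n (ε ^ 2) hn2 (pow_pos hε 2)).continuousOn (s := Icc 0 R)
    have : ContinuousOn (fun r => sm ε (φ r) ^ 2 * Aw n (ε ^ 2) r * (2 / (1 - r ^ 2)) ^ 2)
        (Icc 0 R) := by
      refine ContinuousOn.mul ?_ (hρ.pow 2)
      unfold sm
      fun_prop
    exact this.mono Ioc_subset_Icc_self
  · filter_upwards [self_mem_nhdsWithin] with ε hε
    refine Filter.Eventually.of_forall ?_
    intro r hr
    rw [uIoc_of_le hR0.le] at hr
    have hA := Aw_nonneg n (ε ^ 2) r (sq_nonneg _) hr.1.le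
    rw [Real.norm_of_nonneg (by positivity)]
    have := sm_sq_le ε (φ r) hε
    have h2 := Aw_le n (ε ^ 2) r hn2 (sq_nonneg _) hr.1
    gcongr

theorem quotient_below_sobolev (n R : ℝ) (hn2 : 2 < n) (hn4 : n < 4)
    (hR0 : 0 < R) (hR1 : R < 1)
    (ρ : ℝ → ℝ) (hρ : ρ = fun r : ℝ => 2 / (1 - r ^ 2))
    (Sn ωn μ : ℝ)
    (hS : Sn = π * n * (n - 2) * (Real.Gamma (n / 2) / Real.Gamma n) ^ ((2:ℝ) / n))
    (hω : ωn = 2 * π ^ (n / 2) / Real.Gamma (n / 2))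
    (hμ : μ = sInf { q : ℝ | ∃ φ : ℝ → ℝ,
        ContDiffOn ℝ 1 φ (Icc 0 R) ∧ (∃ r ∈ Icc (0:ℝ) R, φ r ≠ 0) ∧ φ R = 0 ∧
        q = (∫ r in (0:ℝ)..R, (derivWithin φ (Icc 0 R) r) ^ 2 * r ^ (3 - n)) /
            (∫ r in (0:ℝ)..R, (φ r) ^ 2 * r ^ (3 - n) * (ρ r) ^ 2) }) :
    ∀ lam : ℝ, n * (n - 2) / 4 + μ < lam →
      ∃ u u' : ℝ → ℝ,
        (∀ r ∈ Icc (0:ℝ) R, HasDerivWithinAt u (u' r) (Icc 0 R) r) ∧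
        ContinuousOn u' (Icc 0 R) ∧
        (∀ r ∈ Icc (0:ℝ) R, 0 ≤ u r) ∧ (∃ r ∈ Icc (0:ℝ) R, u r ≠ 0) ∧
        u R = 0 ∧
        ωn ^ ((2:ℝ) / n) *
            ((∫ r in (0:ℝ)..R, (u' r) ^ 2 * ρ r ^ (n - 2) * r ^ (n - 1)) -
              lam * ∫ r in (0:ℝ)..R, (u r) ^ 2 * ρ r ^ n * r ^ (n - 1))
          < Sn * (∫ r in (0:ℝ)..R,
              u r ^ (2 * n / (n - 2)) * ρ r ^ n * r ^ (n - 1)) ^ ((n - 2) / n) := by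
  intro lam hlam
  subst hρ
  have hlam' : μ < lam - n * (n - 2) / 4 := by linarith
  rw [hμ] at hlam'
  obtain ⟨q, ⟨φ, hφ1, hne, hφR, hq⟩, hqlt⟩ := exists_lt_of_csInf_lt (by
    exact ⟨_, fun r => R - r, by fun_prop, ⟨0, ⟨le_rfl, hR0.le⟩, by simpa using hR0.ne'⟩,
      by simp, rfl⟩) hlam'
  set φ' := derivWithin φ (Icc 0 R) with hφ'
  have hφc := hφ1.continuousOn
  have hφ'c : ContinuousOn φ' (Icc 0 R) :=
    hφ1.continuousOn_derivWithin (uniqueDiffOn_Icc hR0) le_rfl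
  have hφd : ∀ r ∈ Icc 0 R, HasDerivWithinAt φ (φ' r) (Icc 0 R) r := fun r hr =>
    ((hφ1.differentiableOn one_ne_zero) r hr).hasDerivWithinAt
  have hD := denom_pos_s5 n R hn4 hR0 hR1 φ hφc hne
  rw [hq, div_lt_iff₀ hD] at hqlt
  -- choice of ε
  have hlim := (dct n R hn2 hn4 hR0 hR1 φ hφc).const_mul (lam - n * (n - 2) / 4)
  obtain ⟨ε, hεlt, hε⟩ := ((hlim.eventually_const_lt hqlt).and self_mem_nhdsWithin).exists
  replace hε : 0 < ε := hε
  have he : 0 < ε ^ 2 := by positivity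
  set e := ε ^ 2 with hedef
  set ψ : ℝ → ℝ := fun r => sm ε (φ r) with hψdef
  set ψ' : ℝ → ℝ := fun r => φ r * φ' r / √(φ r ^ 2 + ε ^ 2) with hψ'def
  have hsq : ∀ r, 0 < √(φ r ^ 2 + ε ^ 2) := fun r => Real.sqrt_pos.2 (by positivity)
  have hX : ∀ r ∈ Icc 0 R, 0 < 1 - r ^ 2 := fun r hr => by nlinarith [hr.1, hr.2]
  have hψd : ∀ r ∈ Icc 0 R, HasDerivWithinAt ψ (ψ' r) (Icc 0 R) r := by
    intro r hr
    have h := ((((hφd r hr).pow 2).add_const (ε ^ 2)).sqrt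
      (by simp only [Pi.pow_apply]; positivity)).sub_const ε
    refine h.congr_deriv ?_
    have := hsq r
    simp only [hψ'def, Pi.pow_apply]
    push_cast
    field_simp
  have hψc : ContinuousOn ψ (Icc 0 R) := fun r hr => (hψd r hr).continuousWithinAt
  have hψ'c : ContinuousOn ψ' (Icc 0 R) :=
    ContinuousOn.div (by fun_prop) (by fun_prop) (fun r _ => (hsq r).ne')
  have hψ0 : ∀ r, 0 ≤ ψ r := fun r => sm_nonneg ε _ hε
  have hψR : ψ R = 0 := by simp [hψdef, hφR, sm, Real.sqrt_sq hε.le]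
  have hψ'le : ∀ r, ψ' r ^ 2 ≤ φ' r ^ 2 := by
    intro r
    simp only [hψ'def]
    rw [div_pow, Real.sq_sqrt (by positivity), div_le_iff₀ (by positivity), mul_pow]
    nlinarith [mul_nonneg (sq_nonneg (φ' r)) (sq_nonneg ε)]
  have hA := (Aw_cont n e hn2 he).continuousOn (s := Icc 0 R)
  have hC := (Cw_cont n e hn2 he).continuousOn (s := Icc 0 R)
  have hL := Lw_cont n e R he hR1
  have hgc : ContinuousOn (gw n e) (Icc 0 R) := fun r hr =>
    (gw_deriv n e r he (hX r hr)).continuousAt.continuousWithinAt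
  -- first term
  have hfirst : ∫ r in (0:ℝ)..R, ψ' r ^ 2 * Aw n e r ≤
      ∫ r in (0:ℝ)..R, φ' r ^ 2 * r ^ (3 - n) := by
    apply intervalIntegral.integral_mono_on_of_le_Ioo hR0.le
    · exact ContinuousOn.intervalIntegrable_of_Icc hR0.le (by fun_prop)
    · exact wint n R hn4 hR0 (fun r => φ' r ^ 2) (by fun_prop)
    · intro r hr
      have h1 := Aw_nonneg n e r he.le hr.1.le
      exact mul_le_mul (hψ'le r) (Aw_le n e r hn2 he.le hr.1) h1 (sq_nonneg _)
  have hen := energy n R e hn2 hR0 hR1 he ψ ψ' hψd hψ'c hψR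
  have hhol := holder_lem n R hn2 hR0 ψ (Cw n e) hψc hC (fun r _ => hψ0 r)
    (fun r hr => Cw_nonneg n e r he.le hr.1)
  have hmass := bubble_mass n R e hn2 hR0 he
  refine ⟨fun r => ψ r * gw n e r, fun r => (ψ' r + ψ r * Lw n e r) * gw n e r, ?_, ?_, ?_, ?_,
    ?_, ?_⟩
  · intro r hr
    refine ((hψd r hr).mul (gw_deriv n e r he (hX r hr)).hasDerivWithinAt).congr_deriv ?_
    ring
  · fun_prop
  · intro r hr
    exact mul_nonneg (hψ0 r) (gw_pos n e r he (hX r hr)).le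
  · obtain ⟨r, hr, h⟩ := hne
    exact ⟨r, hr, mul_ne_zero (sm_ne ε _ hε h) (gw_pos n e r he (hX r hr)).ne'⟩
  · simp [hψR]
  have i1 : ∫ r in (0:ℝ)..R, ((ψ' r + ψ r * Lw n e r) * gw n e r) ^ 2 *
      (2 / (1 - r ^ 2)) ^ (n - 2) * r ^ (n - 1) =
      ∫ r in (0:ℝ)..R, (ψ' r + ψ r * Lw n e r) ^ 2 * Aw n e r := by
    apply intervalIntegral.integral_congr
    intro r hr
    rw [uIcc_of_le hR0.le] at hr
    simp only
    rw [← gw_sq n e r he (hX r hr)]; ring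
  have i2 : ∫ r in (0:ℝ)..R, (ψ r * gw n e r) ^ 2 * (2 / (1 - r ^ 2)) ^ n * r ^ (n - 1) =
      ∫ r in (0:ℝ)..R, ψ r ^ 2 * Aw n e r * (2 / (1 - r ^ 2)) ^ 2 := by
    apply intervalIntegral.integral_congr
    intro r hr
    rw [uIcc_of_le hR0.le] at hr
    simp only
    rw [mul_assoc (ψ r ^ 2), ← gw_sq' n e r he (hX r hr)]; ring
  have i3 : ∫ r in (0:ℝ)..R, (ψ r * gw n e r) ^ (2 * n / (n - 2)) * (2 / (1 - r ^ 2)) ^ n *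
      r ^ (n - 1) = ∫ r in (0:ℝ)..R, ψ r ^ (2 * n / (n - 2)) * Cw n e r := by
    apply intervalIntegral.integral_congr
    intro r hr
    rw [uIcc_of_le hR0.le] at hr
    simp only
    rw [← gw_crit n e r hn2 he (hX r hr), mul_rpow (hψ0 r) (gw_pos n e r he (hX r hr)).le]; ring
  simp only [i1, i2, i3]
  have hGp : 0 < Real.Gamma (n / 2) := Real.Gamma_pos_of_pos (by linarith)
  have hωp : 0 < ωn ^ ((2:ℝ) / n) := by rw [hω]; positivity
  set J := ∫ r in (0:ℝ)..R, ψ r ^ (2 * n / (n - 2)) * Cw n e r with hJ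
  have hJ0 : 0 ≤ J := intervalIntegral.integral_nonneg hR0.le (fun r hr =>
    mul_nonneg (rpow_nonneg (hψ0 r) _) (Cw_nonneg n e r he.le hr.1))
  have hM0 : 0 ≤ ∫ r in (0:ℝ)..R, Cw n e r := intervalIntegral.integral_nonneg hR0.le
    (fun r hr => Cw_nonneg n e r he.le hr.1)
  have hn0 : 0 < n := by linarith
  have hM : (∫ r in (0:ℝ)..R, Cw n e r) ^ ((2:ℝ) / n) ≤
      (e ^ (-(n / 2)) * (Real.Gamma (n / 2) ^ 2 / (2 * Real.Gamma n))) ^ ((2:ℝ) / n) :=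
    rpow_le_rpow hM0 hmass (by positivity)
  have hk := const_id n e hn2 he
  rw [← hω, ← hS] at hk
  rw [← hk]
  set K := (e ^ (-(n / 2)) * (Real.Gamma (n / 2) ^ 2 / (2 * Real.Gamma n))) ^ ((2:ℝ) / n)
  have hb : ∫ r in (0:ℝ)..R, ψ r ^ 2 * Cw n e r ≤ J ^ ((n - 2) / n) * K :=
    hhol.trans (mul_le_mul_of_nonneg_left hM (rpow_nonneg hJ0 _))
  have hcoef : 0 ≤ n * (n - 2) * e := by
    have : 0 < n - 2 := by linarith
    positivity
  have hb2 := mul_le_mul_of_nonneg_left hb hcoef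
  rw [mul_assoc (ωn ^ ((2:ℝ) / n))]
  apply mul_lt_mul_of_pos_left _ hωp
  rw [hen]
  have hεlt' : ∫ r in (0:ℝ)..R, φ' r ^ 2 * r ^ (3 - n) < (lam - n * (n - 2) / 4) *
    ∫ r in (0:ℝ)..R, ψ r ^ 2 * Aw n e r * (2 / (1 - r ^ 2)) ^ 2 := hεlt
  linarith

end
end

section
/- Let n be a real parameter with 2 < n < 4, θ1 ∈ (0,∞), p = (n+2)/(n−2), and let λ > n(n−2)/4. If u1 and u2 are both positive solutions of −u''(θ) − (n−1)·coth(θ)·u'(θ) = λ·u(θ) + u(θ)^p on (0,θ1) with u'(0) = 0 and u(θ1) = 0, then u1 = u2. -/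
open Real Set Filter

noncomputable section

/-- A positive solution of the radial Brezis–Nirenberg ODE
`-u'' - (n-1) coth θ u' = λ u + u^p` on `(0,θ1)` with `u'(0) = 0`, `u(θ1) = 0`,
`u > 0` on `[0,θ1)`, `u` continuously differentiable on `[0,θ1]` and twice
differentiable in `(0,θ1)`. -/
def IsPosSol (n θ1 lam p : ℝ) (u : ℝ → ℝ) : Prop :=
  ∃ u' u'' : ℝ → ℝ,
    (∀ θ ∈ Icc (0:ℝ) θ1, HasDerivWithinAt u (u' θ) (Icc 0 θ1) θ) ∧
    ContinuousOn u' (Icc 0 θ1) ∧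
    (∀ θ ∈ Ioo (0:ℝ) θ1, HasDerivAt u' (u'' θ) θ) ∧
    (∀ θ ∈ Ioo (0:ℝ) θ1,
      -u'' θ - (n - 1) * Real.coth θ * u' θ = lam * u θ + u θ ^ p) ∧
    (∀ θ ∈ Ico (0:ℝ) θ1, 0 < u θ) ∧
    u' 0 = 0 ∧ u θ1 = 0

/-- The solution data. -/
structure SolData (n θ1 lam p : ℝ) (u v : ℝ → ℝ) : Prop where
  cu : ContinuousOn u (Icc 0 θ1)
  cv : ContinuousOn v (Icc 0 θ1)
  du : ∀ t ∈ Ioo (0:ℝ) θ1, HasDerivAt u (v t) t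
  dv : ∀ t ∈ Ioo (0:ℝ) θ1,
    HasDerivAt v (-(n - 1) * (cosh t / sinh t) * v t - lam * u t - u t ^ p) t
  dend : HasDerivWithinAt u (v θ1) (Icc 0 θ1) θ1
  pos : ∀ t ∈ Ico (0:ℝ) θ1, 0 < u t
  v0 : v 0 = 0
  uend : u θ1 = 0

theorem solData_of {n θ1 lam p : ℝ} (hθ : 0 < θ1) {u : ℝ → ℝ} (h : IsPosSol n θ1 lam p u) :
    ∃ v, SolData n θ1 lam p u v := by
  obtain ⟨v, v2, h1, h2, h3, h4, h5, h6, h7⟩ := h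
  refine ⟨v, ?_, h2, ?_, ?_, h1 θ1 ⟨hθ.le, le_rfl⟩, h5, h6, h7⟩
  · exact fun t ht => (h1 t ht).continuousWithinAt
  · exact fun t ht => (h1 t ⟨ht.1.le, ht.2.le⟩).hasDerivAt (Icc_mem_nhds ht.1 ht.2)
  · intro t ht
    have := h4 t ht
    unfold Real.coth at this
    convert h3 t ht using 1
    linarith

theorem SolData.nonneg {n θ1 lam p : ℝ} {u v : ℝ → ℝ} (h : SolData n θ1 lam p u v) :
    ∀ t ∈ Icc (0:ℝ) θ1, 0 ≤ u t := by
  intro t ht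
  rcases eq_or_lt_of_le ht.2 with h1 | h1
  · rw [h1, h.uend]
  · exact (h.pos t ⟨ht.1, h1⟩).le

/-- The weight. -/
def wS (n t : ℝ) : ℝ := sinh t ^ (n - 1)

theorem wS_zero {n : ℝ} (hn : 2 < n) : wS n 0 = 0 := by
  unfold wS
  rw [sinh_zero, zero_rpow (by linarith)]

theorem wS_pos {n t : ℝ} (ht : 0 < t) : 0 < wS n t := rpow_pos_of_pos (sinh_pos_iff.2 ht) _

theorem wS_cont {n : ℝ} (hn : 2 < n) : Continuous (wS n) :=
  Real.continuous_sinh.rpow_const (fun _ => Or.inr (by linarith))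

theorem wS_deriv {n t : ℝ} (ht : 0 < t) :
    HasDerivAt (wS n) ((n - 1) * (cosh t / sinh t) * wS n t) t := by
  have hs := sinh_pos_iff.2 ht
  have := (Real.hasDerivAt_sinh t).rpow_const (p := n - 1) (Or.inl hs.ne')
  refine HasDerivAt.congr_deriv this ?_
  rw [rpow_sub_one hs.ne' (n - 1)]
  unfold wS
  field_simp

/-- The Pohozaev energy. -/
def En (n lam p : ℝ) (u v : ℝ → ℝ) (t : ℝ) : ℝ :=
  wS n t * (sinh t * v t ^ 2 / 2 + (n - 2) / 2 * cosh t * (u t * v t)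
    + (lam - (n - 2) / 2) / 2 * sinh t * u t ^ 2
    + (n - 2) / (2 * n) * sinh t * u t ^ (p + 1))

theorem En_cont {n θ1 lam p : ℝ} (hn : 2 < n) (hp : 1 < p) {u v : ℝ → ℝ}
    (h : SolData n θ1 lam p u v) : ContinuousOn (En n lam p u v) (Icc 0 θ1) := by
  have h1 := h.cu
  have h2 := h.cv
  have h3 : ContinuousOn (wS n) (Icc 0 θ1) := (wS_cont hn).continuousOn
  have h4 : ContinuousOn (fun t => u t ^ (p + 1)) (Icc 0 θ1) :=
    h1.rpow_const (fun _ _ => Or.inr (by linarith))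
  have h5 : ContinuousOn sinh (Icc 0 θ1) := Real.continuous_sinh.continuousOn
  have h6 : ContinuousOn cosh (Icc 0 θ1) := Real.continuous_cosh.continuousOn
  unfold En
  fun_prop

theorem En_deriv {n θ1 lam p : ℝ} (hn : 2 < n) (hp : p = (n + 2) / (n - 2)) {u v : ℝ → ℝ}
    (h : SolData n θ1 lam p u v) {t : ℝ} (ht : t ∈ Ioo 0 θ1) :
    HasDerivAt (En n lam p u v)
      ((lam - n * (n - 2) / 4) * cosh t * wS n t * u t ^ 2) t := by
  have hs := sinh_pos_iff.2 ht.1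
  have hu := h.du t ht
  have hv := h.dv t ht
  have hS := wS_deriv (n := n) ht.1
  have hup := h.pos t ⟨ht.1.le, ht.2⟩
  have hr := hu.rpow_const (p := p + 1) (Or.inl hup.ne')
  have hsh := Real.hasDerivAt_sinh t
  have hch := Real.hasDerivAt_cosh t
  have := hS.mul ((((((hsh.mul (hv.pow 2)).div_const 2)).add
    ((hch.const_mul ((n - 2) / 2)).mul (hu.mul hv))).add
    ((hsh.const_mul ((lam - (n - 2) / 2) / 2)).mul (hu.pow 2))).add
    ((hsh.const_mul ((n - 2) / (2 * n))).mul hr))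
  refine HasDerivAt.congr_deriv this ?_
  have e1 : p + 1 - 1 = p := by ring
  have e2 : u t ^ (p + 1) = u t ^ p * u t := by rw [rpow_add_one hup.ne']
  have e3 : p + 1 = 2 * n / (n - 2) := by
    have : n - 2 ≠ 0 := by linarith
    rw [hp]; field_simp; ring
  have e4 : (n - 2) / (2 * n) * (p + 1) = 1 := by
    have : n - 2 ≠ 0 := by linarith
    have : n ≠ 0 := by linarith
    rw [e3]; field_simp
  simp only [Pi.mul_apply, Pi.pow_apply, Pi.add_apply]
  rw [e1, e2]
  generalize u t ^ p = P at *
  have e5 : p = 2 * n / (n - 2) - 1 := by linarith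
  have hcs := Real.cosh_sq t
  have h2 : n - 2 ≠ 0 := by linarith
  have h0 : n ≠ 0 := by linarith
  rw [e3]
  generalize sinh t = s at *
  generalize cosh t = c at *
  generalize u t = U at *
  generalize v t = V at *
  generalize wS n t = S at *
  have hs' := hs.ne'
  push_cast
  field_simp
  ring

theorem En_pos {n θ1 lam p : ℝ} (hn : 2 < n) (hp : p = (n + 2) / (n - 2)) (hp1 : 1 < p)
    (hlam : n * (n - 2) / 4 < lam) {u v : ℝ → ℝ}
    (h : SolData n θ1 lam p u v) {t : ℝ} (ht : t ∈ Ioc 0 θ1) : 0 < En n lam p u v t := by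
  have hm : StrictMonoOn (En n lam p u v) (Icc 0 θ1) := by
    apply strictMonoOn_of_deriv_pos (convex_Icc _ _) (En_cont hn hp1 h)
    intro x hx
    rw [interior_Icc] at hx
    rw [(En_deriv hn hp h hx).deriv]
    have := h.pos x ⟨hx.1.le, hx.2⟩
    have := wS_pos (n := n) hx.1
    have := Real.cosh_pos x
    have : 0 < lam - n * (n - 2) / 4 := by linarith
    positivity
  have := hm ⟨le_rfl, ht.1.le.trans ht.2⟩ ⟨ht.1.le, ht.2⟩ ht.1
  have h0 : En n lam p u v 0 = 0 := by unfold En; rw [wS_zero hn]; ring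
  linarith

/-- Wronskian. -/
def Wr (n : ℝ) (u1 v1 u2 v2 : ℝ → ℝ) (t : ℝ) : ℝ := wS n t * (u1 t * v2 t - u2 t * v1 t)

theorem Wr_cont {n θ1 lam p : ℝ} (hn : 2 < n) {u1 v1 u2 v2 : ℝ → ℝ}
    (h1 : SolData n θ1 lam p u1 v1) (h2 : SolData n θ1 lam p u2 v2) :
    ContinuousOn (Wr n u1 v1 u2 v2) (Icc 0 θ1) := by
  have a1 := h1.cu
  have a2 := h1.cv
  have a3 := h2.cu
  have a4 := h2.cv
  have h3 : ContinuousOn (wS n) (Icc 0 θ1) := (wS_cont hn).continuousOn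
  unfold Wr
  fun_prop

theorem Wr_deriv {n θ1 lam p : ℝ} {u1 v1 u2 v2 : ℝ → ℝ}
    (h1 : SolData n θ1 lam p u1 v1) (h2 : SolData n θ1 lam p u2 v2)
    {t : ℝ} (ht : t ∈ Ioo 0 θ1) :
    HasDerivAt (Wr n u1 v1 u2 v2) (wS n t * (u2 t * u1 t ^ p - u1 t * u2 t ^ p)) t := by
  have := (wS_deriv (n := n) ht.1).mul (((h1.du t ht).mul (h2.dv t ht)).sub
    ((h2.du t ht).mul (h1.dv t ht)))
  refine HasDerivAt.congr_deriv this ?_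
  simp only [Pi.mul_apply, Pi.sub_apply]
  ring

theorem Wr_mono {n θ1 lam p : ℝ} (hn : 2 < n) (hp1 : 1 < p) {u1 v1 u2 v2 : ℝ → ℝ}
    (h1 : SolData n θ1 lam p u1 v1) (h2 : SolData n θ1 lam p u2 v2)
    {b : ℝ} (hb : b ∈ Ioo 0 θ1) (hlt : ∀ t ∈ Ioo 0 b, u2 t < u1 t) :
    ∀ t ∈ Ioc 0 b, 0 < Wr n u1 v1 u2 v2 t := by
  have hm : StrictMonoOn (Wr n u1 v1 u2 v2) (Icc 0 b) := by
    apply strictMonoOn_of_deriv_pos (convex_Icc _ _)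
      ((Wr_cont hn h1 h2).mono (Icc_subset_Icc le_rfl hb.2.le))
    intro x hx
    rw [interior_Icc] at hx
    have hx' : x ∈ Ioo 0 θ1 := ⟨hx.1, hx.2.trans hb.2⟩
    rw [(Wr_deriv h1 h2 hx').deriv]
    have p1 := h1.pos x ⟨hx.1.le, hx'.2⟩
    have p2 := h2.pos x ⟨hx.1.le, hx'.2⟩
    have e1 : u1 x ^ p = u1 x ^ (p - 1) * u1 x := by
      rw [rpow_sub_one p1.ne']; field_simp
    have e2 : u2 x ^ p = u2 x ^ (p - 1) * u2 x := by
      rw [rpow_sub_one p2.ne']; field_simp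
    have := rpow_lt_rpow p2.le (hlt x hx) (by linarith : 0 < p - 1)
    apply mul_pos (wS_pos hx.1)
    rw [e1, e2]
    have := mul_pos (mul_pos p1 p2) (sub_pos.2 this)
    linarith
  intro t ht
  have := hm ⟨le_rfl, hb.1.le⟩ ⟨ht.1.le, ht.2⟩ ht.1
  have h0 : Wr n u1 v1 u2 v2 0 = 0 := by unfold Wr; rw [wS_zero hn]; ring
  linarith

/-- `w ^ 2 * E1 - E2`. -/
def Xf (n lam p : ℝ) (u1 v1 u2 v2 : ℝ → ℝ) (t : ℝ) : ℝ :=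
  (u2 t / u1 t) ^ 2 * En n lam p u1 v1 t - En n lam p u2 v2 t

theorem w_deriv {n θ1 lam p : ℝ} {u1 v1 u2 v2 : ℝ → ℝ}
    (h1 : SolData n θ1 lam p u1 v1) (h2 : SolData n θ1 lam p u2 v2)
    {t : ℝ} (ht : t ∈ Ioo 0 θ1) :
    HasDerivAt (fun t => u2 t / u1 t) (Wr n u1 v1 u2 v2 t / (wS n t * u1 t ^ 2)) t := by
  have p1 := h1.pos t ⟨ht.1.le, ht.2⟩
  have hS := wS_pos (n := n) ht.1
  refine HasDerivAt.congr_deriv ((h2.du t ht).div (h1.du t ht) p1.ne') ?_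
  unfold Wr
  field_simp

theorem w_cont {n θ1 lam p : ℝ} {u1 v1 u2 v2 : ℝ → ℝ}
    (h1 : SolData n θ1 lam p u1 v1) (h2 : SolData n θ1 lam p u2 v2) :
    ContinuousOn (fun t => u2 t / u1 t) (Ico 0 θ1) :=
  (h2.cu.mono Ico_subset_Icc_self).div (h1.cu.mono Ico_subset_Icc_self)
    (fun t ht => (h1.pos t ht).ne')

theorem mono_of_Wr {n θ1 lam p : ℝ} (hn : 2 < n) (hp : p = (n + 2) / (n - 2)) (hp1 : 1 < p)
    (hlam : n * (n - 2) / 4 < lam) {u1 v1 u2 v2 : ℝ → ℝ}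
    (h1 : SolData n θ1 lam p u1 v1) (h2 : SolData n θ1 lam p u2 v2)
    {b : ℝ} (hb : b ∈ Ioo 0 θ1) (hW : ∀ t ∈ Ioo 0 b, 0 < Wr n u1 v1 u2 v2 t) :
    StrictMonoOn (fun t => u2 t / u1 t) (Icc 0 b) ∧
    StrictMonoOn (Xf n lam p u1 v1 u2 v2) (Icc 0 b) := by
  have hsub : Icc 0 b ⊆ Ico 0 θ1 := fun t ht => ⟨ht.1, ht.2.trans_lt hb.2⟩
  have hwpos : ∀ x ∈ Ioo 0 b, 0 < Wr n u1 v1 u2 v2 x / (wS n x * u1 x ^ 2) := by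
    intro x hx
    have := h1.pos x ⟨hx.1.le, hx.2.trans hb.2⟩
    have := wS_pos (n := n) hx.1
    have := hW x hx
    positivity
  have hwc := (w_cont h1 h2).mono hsub
  constructor
  · apply strictMonoOn_of_deriv_pos (convex_Icc _ _) hwc
    intro x hx
    rw [interior_Icc] at hx
    rw [(w_deriv h1 h2 ⟨hx.1, hx.2.trans hb.2⟩).deriv]
    exact hwpos x hx
  · apply strictMonoOn_of_deriv_pos (convex_Icc _ _)
    · exact ((hwc.pow 2).mul ((En_cont hn hp1 h1).mono (Icc_subset_Icc le_rfl hb.2.le))).sub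
        ((En_cont hn hp1 h2).mono (Icc_subset_Icc le_rfl hb.2.le))
    intro x hx
    rw [interior_Icc] at hx
    have hx' : x ∈ Ioo 0 θ1 := ⟨hx.1, hx.2.trans hb.2⟩
    have p1 := h1.pos x ⟨hx.1.le, hx'.2⟩
    have p2 := h2.pos x ⟨hx.1.le, hx'.2⟩
    have hE := En_pos hn hp hp1 hlam h1 ⟨hx'.1, hx'.2.le⟩
    have hd : HasDerivAt (Xf n lam p u1 v1 u2 v2)
        (2 * (u2 x / u1 x) * (Wr n u1 v1 u2 v2 x / (wS n x * u1 x ^ 2)) * En n lam p u1 v1 x) x := by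
      refine HasDerivAt.congr_deriv ((((w_deriv (n := n) h1 h2 hx').pow 2).mul
        (En_deriv hn hp h1 hx')).sub (En_deriv hn hp h2 hx')) ?_
      simp only [Pi.pow_apply]
      push_cast
      field_simp
      ring
    rw [hd.deriv]
    have := hwpos x hx
    positivity

theorem Xf_zero {n lam p : ℝ} (hn : 2 < n) {u1 v1 u2 v2 : ℝ → ℝ} :
    Xf n lam p u1 v1 u2 v2 0 = 0 := by
  unfold Xf En; rw [wS_zero hn]; ring

theorem Xf_neg {n lam p : ℝ} (hn : 2 < n) (hp1 : 1 < p) {u1 v1 u2 v2 : ℝ → ℝ}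
    {t : ℝ} (ht : 0 < t) (p1 : 0 < u1 t) (hw : 1 < u2 t / u1 t)
    (hW : Wr n u1 v1 u2 v2 t = 0) : Xf n lam p u1 v1 u2 v2 t < 0 := by
  have hS := wS_pos (n := n) ht
  have hs := sinh_pos_iff.2 ht
  have hW' : u1 t * v2 t - u2 t * v1 t = 0 := by
    unfold Wr at hW
    rcases mul_eq_zero.1 hW with h | h
    · exact absurd h hS.ne'
    · exact h
  set w := u2 t / u1 t with hwdef
  have hw0 : 0 < w := by linarith
  have e1 : u2 t = w * u1 t := by rw [hwdef]; field_simp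
  have e2 : v2 t = w * v1 t := by
    rw [e1] at hW'
    have : u1 t * (v2 t - w * v1 t) = 0 := by linarith
    rcases mul_eq_zero.1 this with h | h
    · exact absurd h p1.ne'
    · linarith
  have e3 : (w * u1 t) ^ (p + 1) = w ^ (p + 1) * u1 t ^ (p + 1) := mul_rpow hw0.le p1.le
  have e4 : w ^ 2 < w ^ (p + 1) := by
    have := rpow_lt_rpow_of_exponent_lt hw (by linarith : (2:ℝ) < p + 1)
    rwa [rpow_two] at this
  have hc : 0 < (n - 2) / (2 * n) := by
    have : 0 < n - 2 := by linarith
    positivity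
  have hu : 0 < u1 t ^ (p + 1) := rpow_pos_of_pos p1 _
  have key : Xf n lam p u1 v1 u2 v2 t =
      -(wS n t * ((n - 2) / (2 * n)) * sinh t * u1 t ^ (p + 1) * (w ^ (p + 1) - w ^ 2)) := by
    unfold Xf En
    rw [← hwdef, e2, e1, e3]
    ring
  rw [key]
  have : 0 < w ^ (p + 1) - w ^ 2 := by linarith
  have : 0 < wS n t * ((n - 2) / (2 * n)) * sinh t * u1 t ^ (p + 1) * (w ^ (p + 1) - w ^ 2) := by
    positivity
  linarith

theorem not_lt_zero_val {n θ1 lam p : ℝ} (hn : 2 < n) (hθ : 0 < θ1)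
    (hp : p = (n + 2) / (n - 2)) (hp1 : 1 < p)
    (hlam : n * (n - 2) / 4 < lam) {u1 v1 u2 v2 : ℝ → ℝ}
    (h1 : SolData n θ1 lam p u1 v1) (h2 : SolData n θ1 lam p u2 v2) : ¬ u2 0 < u1 0 := by
  intro h0
  have hmem0 : (0:ℝ) ∈ Ico 0 θ1 := ⟨le_rfl, hθ⟩
  -- positivity of the Wronskian
  have hWpos : ∀ b ∈ Ioo 0 θ1, 0 < Wr n u1 v1 u2 v2 b := by
    by_contra! hcon
    obtain ⟨b, hb, hWb⟩ := hcon
    -- near zero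
    obtain ⟨δ, hδ, hδW⟩ : ∃ δ ∈ Ioo 0 θ1, ∀ t ∈ Ioc 0 δ, 0 < Wr n u1 v1 u2 v2 t := by
      have c1 := h1.cu 0 ⟨le_rfl, hθ.le⟩
      have c2 := h2.cu 0 ⟨le_rfl, hθ.le⟩
      have hev := c2.eventually_lt c1 h0
      rw [eventually_nhdsWithin_iff, Metric.eventually_nhds_iff] at hev
      obtain ⟨ε, hε, hev⟩ := hev
      have hd : min (ε / 2) (θ1 / 2) ∈ Ioo 0 θ1 :=
        ⟨by positivity, (min_le_right _ _).trans_lt (by linarith)⟩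
      refine ⟨min (ε / 2) (θ1 / 2), hd, Wr_mono hn hp1 h1 h2 hd ?_⟩
      intro t ht
      apply hev
      · rw [Real.dist_eq, sub_zero, abs_of_pos ht.1]
        have := ht.2.trans_le (min_le_left _ _)
        linarith
      · exact ⟨ht.1.le, (ht.2.trans hd.2).le⟩
    have hδb : δ < b := by
      by_contra! hc
      have := hδW b ⟨hb.1, hc⟩
      linarith
    -- first zero
    let K : Set ℝ := Icc δ b ∩ (Wr n u1 v1 u2 v2) ⁻¹' Iic 0
    have hcW : ContinuousOn (Wr n u1 v1 u2 v2) (Icc δ b) :=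
      (Wr_cont hn h1 h2).mono (Icc_subset_Icc hδ.1.le hb.2.le)
    have hKc : IsClosed K := hcW.preimage_isClosed_of_isClosed isClosed_Icc isClosed_Iic
    have hKn : K.Nonempty := ⟨b, ⟨hδb.le, le_rfl⟩, hWb⟩
    have hKb : BddBelow K := ⟨δ, fun x hx => hx.1.1⟩
    have hmem := hKc.csInf_mem hKn hKb
    set t0 := sInf K with ht0
    have ht0W : Wr n u1 v1 u2 v2 t0 ≤ 0 := hmem.2
    have hδt0 : δ < t0 := by
      rcases eq_or_lt_of_le hmem.1.1 with h | h
      · have := hδW δ ⟨hδ.1, le_rfl⟩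
        rw [h] at this
        linarith
      · exact h
    have ht0m : t0 ∈ Ioo 0 θ1 := ⟨hδ.1.trans hδt0, hmem.1.2.trans_lt hb.2⟩
    have hbefore : ∀ t ∈ Ioo 0 t0, 0 < Wr n u1 v1 u2 v2 t := by
      intro t ht
      rcases le_or_gt t δ with h | h
      · exact hδW t ⟨ht.1, h⟩
      · by_contra! hc
        have : t0 ≤ t := csInf_le hKb ⟨⟨h.le, ht.2.le.trans hmem.1.2⟩, hc⟩
        linarith [ht.2]
    have ht0z : Wr n u1 v1 u2 v2 t0 = 0 := by
      apply le_antisymm ht0W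
      have hc : ContinuousOn (Wr n u1 v1 u2 v2) (closure (Ioo 0 t0)) := by
        rw [closure_Ioo ht0m.1.ne]
        exact (Wr_cont hn h1 h2).mono (Icc_subset_Icc le_rfl ht0m.2.le)
      have := le_on_closure (f := fun _ => (0:ℝ)) (fun x hx => (hbefore x hx).le)
        continuousOn_const hc (x := t0)
      apply this
      rw [closure_Ioo ht0m.1.ne]
      exact ⟨ht0m.1.le, le_rfl⟩
    obtain ⟨mw, mX⟩ := mono_of_Wr hn hp hp1 hlam h1 h2 ht0m hbefore
    have hX0 := mX ⟨le_rfl, ht0m.1.le⟩ ⟨ht0m.1.le, le_rfl⟩ ht0m.1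
    rw [Xf_zero hn] at hX0
    have hw1 : 1 < u2 t0 / u1 t0 := by
      by_contra! hc
      have : 0 < Wr n u1 v1 u2 v2 t0 := by
        apply Wr_mono hn hp1 h1 h2 ht0m _ t0 ⟨ht0m.1, le_rfl⟩
        intro t ht
        have h3 := mw ⟨ht.1.le, ht.2.le⟩ ⟨ht0m.1.le, le_rfl⟩ ht.2
        have h4 : u2 t / u1 t < 1 := lt_of_lt_of_le h3 hc
        rwa [div_lt_one (h1.pos t ⟨ht.1.le, ht.2.trans ht0m.2⟩)] at h4
      linarith
    have := Xf_neg (lam := lam) hn hp1 ht0m.1 (h1.pos t0 ⟨ht0m.1.le, ht0m.2⟩) hw1 ht0z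
    linarith
  -- limit at the right end
  have hV1 : v1 θ1 ≠ 0 := by
    intro hv
    have := En_pos hn hp hp1 hlam h1 ⟨hθ, le_rfl⟩
    unfold En at this
    rw [h1.uend, hv, zero_rpow (by linarith)] at this
    simp at this
  have hset : Icc 0 θ1 \ {θ1} = Ico 0 θ1 := Icc_sdiff_right
  have s1 := h1.dend
  have s2 := h2.dend
  rw [hasDerivWithinAt_iff_tendsto_slope, hset] at s1 s2
  have hw : Tendsto (fun t => u2 t / u1 t) (nhdsWithin θ1 (Ico 0 θ1)) (nhds (v2 θ1 / v1 θ1)) := by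
    refine (s2.div s1 hV1).congr' ?_
    filter_upwards [self_mem_nhdsWithin] with t ht
    have : t - θ1 ≠ 0 := by linarith [ht.2]
    have := (h1.pos t ht).ne'
    have g1 : slope u1 θ1 t = u1 t / (t - θ1) := by rw [slope_def_field, h1.uend, sub_zero]
    have g2 : slope u2 θ1 t = u2 t / (t - θ1) := by rw [slope_def_field, h2.uend, sub_zero]
    change slope u2 θ1 t / slope u1 θ1 t = _
    rw [g1, g2]
    field_simp
  have c1 : Tendsto (En n lam p u1 v1) (nhdsWithin θ1 (Ico 0 θ1)) (nhds (En n lam p u1 v1 θ1)) :=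
    ((En_cont hn hp1 h1) θ1 ⟨hθ.le, le_rfl⟩).mono_left (nhdsWithin_mono _ Ico_subset_Icc_self)
  have c2 : Tendsto (En n lam p u2 v2) (nhdsWithin θ1 (Ico 0 θ1)) (nhds (En n lam p u2 v2 θ1)) :=
    ((En_cont hn hp1 h2) θ1 ⟨hθ.le, le_rfl⟩).mono_left (nhdsWithin_mono _ Ico_subset_Icc_self)
  have hX : Tendsto (Xf n lam p u1 v1 u2 v2) (nhdsWithin θ1 (Ico 0 θ1)) (nhds 0) := by
    have := ((hw.pow 2).mul c1).sub c2
    have e : (v2 θ1 / v1 θ1) ^ 2 * En n lam p u1 v1 θ1 - En n lam p u2 v2 θ1 = 0 := by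
      unfold En
      rw [h1.uend, h2.uend, zero_rpow (by linarith)]
      field_simp
      ring
    rw [e] at this
    exact this
  have hmid : θ1 / 2 ∈ Ioo 0 θ1 := ⟨by linarith, by linarith⟩
  have hXmid : 0 < Xf n lam p u1 v1 u2 v2 (θ1 / 2) := by
    have := (mono_of_Wr hn hp hp1 hlam h1 h2 hmid
      (fun t ht => hWpos t ⟨ht.1, ht.2.trans hmid.2⟩)).2 ⟨le_rfl, hmid.1.le⟩
        ⟨hmid.1.le, le_rfl⟩ hmid.1
    rwa [Xf_zero hn] at this
  have hne : (nhdsWithin θ1 (Ico 0 θ1)).NeBot := by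
    rw [← mem_closure_iff_nhdsWithin_neBot, closure_Ico hθ.ne]
    exact ⟨hθ.le, le_rfl⟩
  have hge : Xf n lam p u1 v1 u2 v2 (θ1 / 2) ≤ 0 := by
    apply ge_of_tendsto hX
    have hI : Ioi (θ1 / 2) ∈ nhdsWithin θ1 (Ico 0 θ1) :=
      mem_nhdsWithin_of_mem_nhds (Ioi_mem_nhds hmid.2)
    filter_upwards [self_mem_nhdsWithin, hI] with t ht ht2
    have ht2' : θ1 / 2 < t := ht2
    have htm : t ∈ Ioo 0 θ1 := ⟨hmid.1.trans ht2', ht.2⟩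
    exact ((mono_of_Wr hn hp hp1 hlam h1 h2 htm
      (fun x hx => hWpos x ⟨hx.1, hx.2.trans htm.2⟩)).2 ⟨hmid.1.le, ht2'.le⟩
        ⟨htm.1.le, le_rfl⟩ ht2').le
  linarith

theorem eq_of_zero_val {n θ1 lam p : ℝ} (hn : 2 < n) (hp1 : 1 < p) {u1 v1 u2 v2 : ℝ → ℝ}
    (h1 : SolData n θ1 lam p u1 v1) (h2 : SolData n θ1 lam p u2 v2) (h0 : u1 0 = u2 0) :
    EqOn u1 u2 (Icc 0 θ1) := by
  obtain ⟨M1, hM1⟩ := isCompact_Icc.bddAbove_image h1.cu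
  obtain ⟨M2, hM2⟩ := isCompact_Icc.bddAbove_image h2.cu
  set M := max (max M1 M2) 0 with hM
  have hM0 : 0 ≤ M := le_max_right _ _
  have b1 : ∀ t ∈ Icc 0 θ1, u1 t ∈ Icc 0 M := fun t ht =>
    ⟨h1.nonneg t ht, (hM1 ⟨t, ht, rfl⟩).trans ((le_max_left _ _).trans (le_max_left _ _))⟩
  have b2 : ∀ t ∈ Icc 0 θ1, u2 t ∈ Icc 0 M := fun t ht =>
    ⟨h2.nonneg t ht, (hM2 ⟨t, ht, rfl⟩).trans ((le_max_right _ _).trans (le_max_left _ _))⟩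
  set L := p * M ^ (p - 1) with hL
  have hL0 : 0 ≤ L := by positivity
  have lip : ∀ x ∈ Icc 0 M, ∀ y ∈ Icc 0 M, |y ^ p - x ^ p| ≤ L * |y - x| := by
    intro x hx y hy
    have := Convex.norm_image_sub_le_of_norm_hasDerivWithin_le (f := fun x : ℝ => x ^ p)
      (f' := fun x => p * x ^ (p - 1)) (s := Icc 0 M) (C := L)
      (fun z hz => (Real.hasDerivAt_rpow_const (Or.inr hp1.le)).hasDerivWithinAt) ?_
      (convex_Icc _ _) hx hy
    · simpa [Real.norm_eq_abs] using this
    · intro z hz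
      have := rpow_nonneg hz.1 (p - 1)
      rw [Real.norm_eq_abs, abs_of_nonneg (by positivity)]
      have := rpow_le_rpow hz.1 hz.2 (by linarith : 0 ≤ p - 1)
      exact mul_le_mul_of_nonneg_left this (by linarith)
  set C := |lam| + L + 1 with hC
  let e : ℝ → ℝ := fun t => ((u1 t - u2 t) ^ 2 + (v1 t - v2 t) ^ 2) * Real.exp (-(C * t))
  have hanti : AntitoneOn e (Icc 0 θ1) := by
    have hd : ∀ x ∈ Ioo 0 θ1, HasDerivAt e
        ((2 * (u1 x - u2 x) * (v1 x - v2 x) + 2 * (v1 x - v2 x) *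
          (-(n - 1) * (cosh x / sinh x) * (v1 x - v2 x) - lam * (u1 x - u2 x)
            - (u1 x ^ p - u2 x ^ p))
          - C * ((u1 x - u2 x) ^ 2 + (v1 x - v2 x) ^ 2)) * Real.exp (-(C * x))) x := by
      intro x hx
      have he : HasDerivAt (fun t => Real.exp (-(C * t))) (Real.exp (-(C * x)) * (-(C * 1))) x :=
        (((hasDerivAt_id x).const_mul C).neg).exp
      refine HasDerivAt.congr_deriv
        (((((h1.du x hx).sub (h2.du x hx)).pow 2).add
          (((h1.dv x hx).sub (h2.dv x hx)).pow 2)).mul he) ?_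
      simp only [Pi.pow_apply, Pi.add_apply, Pi.sub_apply]
      push_cast
      ring
    apply antitoneOn_of_deriv_nonpos (convex_Icc _ _)
    · have a1 := h1.cu
      have a2 := h1.cv
      have a3 := h2.cu
      have a4 := h2.cv
      fun_prop
    · intro x hx
      rw [interior_Icc] at hx
      exact (hd x hx).differentiableAt.differentiableWithinAt
    · intro x hx
      rw [interior_Icc] at hx
      rw [(hd x hx).deriv]
      apply mul_nonpos_of_nonpos_of_nonneg _ (Real.exp_pos _).le
      have hx' : x ∈ Icc 0 θ1 := ⟨hx.1.le, hx.2.le⟩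
      have hl := lip _ (b2 x hx') _ (b1 x hx')
      generalize u1 x ^ p - u2 x ^ p = P at *
      generalize u1 x - u2 x = d at *
      generalize v1 x - v2 x = f at *
      have hcoth : 0 ≤ (n - 1) * (cosh x / sinh x) := by
        have := sinh_pos_iff.2 hx.1
        have := Real.cosh_pos x
        have : 0 < n - 1 := by linarith
        positivity
      have t1 : 0 ≤ (n - 1) * (cosh x / sinh x) * f ^ 2 := by positivity
      have t2 : 2 * |d| * |f| ≤ d ^ 2 + f ^ 2 := by
        have := two_mul_le_add_sq |d| |f|
        simpa [sq_abs] using this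
      have t3 : d * f ≤ |d| * |f| := by rw [← abs_mul]; exact le_abs_self _
      have t4 : -(lam * (d * f)) ≤ |lam| * (|d| * |f|) := by
        rw [← abs_mul, ← abs_mul]; exact neg_le_abs _
      have t5 : -(P * f) ≤ L * (|d| * |f|) := by
        calc -(P * f) ≤ |P * f| := neg_le_abs _
          _ = |P| * |f| := abs_mul _ _
          _ ≤ L * |d| * |f| := by gcongr
          _ = _ := by ring
      have t6 : C * (2 * |d| * |f|) ≤ C * (d ^ 2 + f ^ 2) := by
        have : 0 ≤ C := by positivity
        gcongr
      rw [hC] at t6 ⊢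
      linarith
  intro t ht
  have hθ : 0 ≤ θ1 := ht.1.trans ht.2
  have := hanti ⟨le_rfl, hθ⟩ ht ht.1
  have e0 : e 0 = 0 := by simp [e, h0, h1.v0, h2.v0]
  rw [e0] at this
  have hexp := Real.exp_pos (-(C * t))
  have h3 : (u1 t - u2 t) ^ 2 + (v1 t - v2 t) ^ 2 ≤ 0 := by
    by_contra! hc
    have h5 := mul_pos hc hexp
    change _ ≤ (0:ℝ) at this
    simp only [e] at this
    linarith
  have h4 : (u1 t - u2 t) ^ 2 = 0 := by
    nlinarith [sq_nonneg (u1 t - u2 t), sq_nonneg (v1 t - v2 t)]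
  have := pow_eq_zero_iff (two_ne_zero) |>.1 h4
  linarith

/-- Uniqueness (Section 5): for `2 < n < 4` and `λ > n(n-2)/4`, the
Brezis–Nirenberg problem on a geodesic ball of radius `θ1` in hyperbolic
space has at most one positive radial solution. -/
theorem brezis_nirenberg_hyperbolic_uniqueness (n θ1 lam p : ℝ)
    (hn2 : 2 < n) (hn4 : n < 4) (hθ1 : 0 < θ1)
    (hp : p = (n + 2) / (n - 2)) (hlam : n * (n - 2) / 4 < lam)
    (u1 u2 : ℝ → ℝ)
    (h1 : IsPosSol n θ1 lam p u1) (h2 : IsPosSol n θ1 lam p u2) :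
    EqOn u1 u2 (Icc 0 θ1) := by
  have hp1 : 1 < p := by
    rw [hp, lt_div_iff₀ (by linarith)]; linarith
  obtain ⟨v1, s1⟩ := solData_of hθ1 h1
  obtain ⟨v2, s2⟩ := solData_of hθ1 h2
  apply eq_of_zero_val hn2 hp1 s1 s2
  apply le_antisymm
  · exact not_lt.1 (not_lt_zero_val hn2 hθ1 hp hp1 hlam s1 s2)
  · exact not_lt.1 (not_lt_zero_val hn2 hθ1 hp hp1 hlam s2 s1)

end
end
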